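/- arXiv:1812.04979 — 3 statements merged into one kernel-verified Lean document; each statement's English description precedes it below -/
import Mathlib

section
/- Let k be an algebraically closed field and let B be a unique factorization domain containing k such that B has transcendence degree 2 over k, the fraction field of B is a purely transcendental extension of k of transcendence degree 2, and B admits a positive ℤ-grading over k. Then there exist n ≥ 0, pairwise relatively prime integers a > b > c_1 > ⋯ > c_n ≥ 2, and distinct elements λ_1 = 1, λ_2, …, λ_n ∈ k* such that B ≅_k k[x, y, z_1, …, z_n]/(x^a + λ_i y^b + z_i^{c_i})_{1 ≤ i ≤ n}. In particular, B is a finitely generated k-algebra. -/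
set_option synthInstance.maxHeartbeats 1000000
set_option maxHeartbeats 1000000

open MvPolynomial

/-- The ring `k[x, y, z_1, …, z_n] / (x^a + λ_i y^b + z_i^{c_i})_{1 ≤ i ≤ n}`,
with `x = X 0`, `y = X 1`, `z_i = X (i+1)` and relations indexed by `i : Fin n`. -/
abbrev MoriRing (k : Type*) [CommRing k] (n : ℕ) (a b : ℕ) (c : Fin n → ℕ)
    (lam : Fin n → k) :=
  MvPolynomial (Fin (n + 2)) k ⧸
    Ideal.span (Set.range fun i : Fin n =>
      (X 0 : MvPolynomial (Fin (n + 2)) k) ^ a + C (lam i) * X 1 ^ b +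
        X i.succ.succ ^ c i)

/-- `B` admits a positive ℤ-grading over `k`. -/
def HasPositiveZGrading (k B : Type*) [CommRing k] [CommRing B] [Algebra k B] : Prop :=
  ∃ 𝒜 : ℤ → Submodule k B, Nonempty (GradedAlgebra 𝒜) ∧
    (∀ i : ℤ, i < 0 → 𝒜 i = ⊥) ∧ 𝒜 0 = 1

theorem aeval_kronecker_ne_zero {k : Type*} [Field k] {P : MvPolynomial (Fin 2) k} (hP : P ≠ 0)
    {n : ℕ} (hn : P.totalDegree < n) :
    aeval ![(Polynomial.X : Polynomial k), Polynomial.X ^ n] P ≠ 0 := by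
  obtain ⟨m, hm⟩ := MvPolynomial.support_nonempty.2 hP
  intro h
  have hdeg : ∀ m ∈ P.support, m 0 < n := fun m hm =>
    ((Finsupp.le_degree 0 m).trans (MvPolynomial.le_totalDegree hm)).trans_lt hn
  have key := congrArg (fun q => Polynomial.coeff q (m 0 + n * m 1)) h
  simp only [aeval_def, eval₂_eq', Polynomial.finsetSum_coeff, Fin.prod_univ_two,
    Matrix.cons_val_zero, Matrix.cons_val_one, Polynomial.coeff_zero, ← pow_mul, ← pow_add,
    Polynomial.algebraMap_eq, Polynomial.coeff_C_mul, Polynomial.coeff_X_pow, mul_ite, mul_one,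
    mul_zero] at key
  rw [Finset.sum_eq_single m] at key
  · simp at key
    exact (mem_support_iff.1 hm) key
  · intro b hb hbm
    rw [if_neg]
    intro he
    apply hbm
    have h0 : b 0 = m 0 := by
      have := congrArg (· % n) he
      simpa [Nat.mod_eq_of_lt (hdeg b hb), Nat.mod_eq_of_lt (hdeg m hm)] using this.symm
    have h1 : b 1 = m 1 := by
      have hn0 : 0 < n := by omega
      rw [h0] at he
      exact (Nat.eq_of_mul_eq_mul_left hn0 (by omega))
    ext i
    fin_cases i
    · exact h0
    · exact h1
  · intro h'; exact absurd hm h'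

theorem nonempty_algHom_ratFunc {k : Type*} [Field k] {E K : Type*} [Field E] [Field K]
    [Algebra k E] [Algebra k K] [Algebra (MvPolynomial (Fin 2) k) K]
    [IsScalarTower k (MvPolynomial (Fin 2) k) K] [IsFractionRing (MvPolynomial (Fin 2) k) K]
    (j : E →ₐ[k] K) {w : E} (hw : Transcendental k w)
    [Algebra.IsAlgebraic (Algebra.adjoin k {w}) E] : Nonempty (E →ₐ[k] RatFunc k) := by
  let R := MvPolynomial (Fin 2) k
  obtain ⟨P, Q, hQ, hPQ⟩ := IsFractionRing.div_surjective (A := R) (j w)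
  have hQ0 : Q ≠ 0 := nonZeroDivisors.ne_zero hQ
  let n := max P.totalDegree Q.totalDegree + 1
  let π : R →ₐ[k] Polynomial k := aeval ![Polynomial.X, Polynomial.X ^ n]
  let p : Ideal R := RingHom.ker π
  have hp : p.IsPrime := RingHom.ker_isPrime _
  have hM : p.primeCompl ≤ nonZeroDivisors R := p.primeCompl_le_nonZeroDivisors
  let O := Localization.subalgebra.ofField K p.primeCompl hM
  let f : R →ₐ[k] RatFunc k := (IsScalarTower.toAlgHom k (Polynomial k) (RatFunc k)).comp π
  have hf : ∀ a : R, f a = 0 ↔ π a = 0 := fun a => by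
    change algebraMap (Polynomial k) (RatFunc k) (π a) = 0 ↔ _
    simp
  have hfu : ∀ s : p.primeCompl, IsUnit (f s) := fun s => by
    rw [isUnit_iff_ne_zero, Ne, hf]
    exact s.2
  let ρ : O →ₐ[k] RatFunc k := IsLocalization.liftAlgHom (M := p.primeCompl) (S := O) hfu
  have hρ : ∀ a : R, ρ (algebraMap R O a) = f a := fun a => by
    exact IsLocalization.lift_eq _ a
  have hunit : ∀ y : O, ρ y ≠ 0 → IsUnit y := by
    intro y hy
    obtain ⟨a, s, rfl⟩ := IsLocalization.exists_mk'_eq p.primeCompl y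
    have hmul : IsLocalization.mk' O a s * algebraMap R O s = algebraMap R O a :=
      IsLocalization.mk'_spec _ _ _
    have ha : f a ≠ 0 := by
      rw [← hρ, ← hmul, map_mul, hρ]
      exact mul_ne_zero hy (hfu s).ne_zero
    have hau : IsUnit (algebraMap R O a) :=
      IsLocalization.map_units O (⟨a, fun h => ha ((hf a).2 h)⟩ : p.primeCompl)
    rw [← hmul] at hau
    exact isUnit_of_mul_isUnit_left hau
  have hlin : ∀ α β : k, C α * P + C β * Q ≠ 0 → π (C α * P + C β * Q) ≠ 0 := by
    intro α β h
    refine aeval_kronecker_ne_zero h ?_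
    refine Nat.lt_succ_of_le ((totalDegree_add _ _).trans (max_le_max ?_ ?_))
    · exact (totalDegree_mul _ _).trans (by simp)
    · exact (totalDegree_mul _ _).trans (by simp)
  have hπQ : π Q ≠ 0 := by simpa using hlin 0 1 (by simpa using hQ0)
  have hwO : j w ∈ O := ⟨P, Q, hπQ, by rw [← hPQ, div_eq_mul_inv]⟩
  let w' : O := ⟨j w, hwO⟩
  have hw'Q : w' * algebraMap R O Q = algebraMap R O P := by
    apply Subtype.ext
    change j w * algebraMap R K Q = algebraMap R K P
    rw [← hPQ, div_mul_cancel₀]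
    simpa using hQ0
  have hρw : Transcendental k (ρ w') := by
    apply RatFunc.transcendental_of_ne_C
    rintro ⟨c, hc⟩
    have h1 := congrArg ρ hw'Q
    rw [map_mul, hρ, hρ, hc] at h1
    have h2 : π (C 1 * P + C (-c) * Q) = 0 := by
      rw [← hf, map_add, map_mul, map_mul, ← h1]
      have e1 : f (C 1) = 1 := by simp
      have e2 : f (C (-c)) = - RatFunc.C c := by
        rw [← algebraMap_eq, AlgHom.commutes, map_neg]
        rfl
      rw [e1, e2]; ring
    by_cases h0 : C 1 * P + C (-c) * Q = 0
    · apply hw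
      have hP : P = C c * Q := by
        simp at h0
        linear_combination h0
      have : j w = j (algebraMap k E c) := by
        rw [← hPQ, hP, map_mul, AlgHom.commutes, mul_div_cancel_right₀]
        · rw [IsScalarTower.algebraMap_apply k R K]; rfl
        · simpa using hQ0
      rw [j.injective this]
      exact isAlgebraic_algebraMap c
    · exact hlin _ _ h0 h2
  have hint : IsIntegrallyClosed O := isIntegrallyClosed_of_isLocalization O p.primeCompl hM
  have hadj : ∀ y ∈ Algebra.adjoin k {w}, ∃ q : Polynomial k, Polynomial.aeval w q = y :=
    fun y hy => by rwa [Algebra.adjoin_singleton_eq_range_aeval] at hy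
  have hmem : ∀ x : E, j x ∈ O := by
    intro x
    obtain ⟨y, hy0, hy⟩ :=
      (Algebra.IsAlgebraic.isAlgebraic (R := Algebra.adjoin k {w}) x).exists_integral_multiple
    obtain ⟨q, hq⟩ := hadj y y.2
    let y' : O := Polynomial.aeval w' q
    have hy' : (y' : K) = j y := by
      rw [← hq, ← Polynomial.aeval_algHom_apply]
      exact (Polynomial.aeval_algHom_apply (O.val.restrictScalars k) w' q).symm
    have hyu : IsUnit y' := by
      apply hunit
      rw [← Polynomial.aeval_algHom_apply]
      have hq0 : q ≠ 0 := by
        rintro rfl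
        apply hy0
        apply Subtype.ext
        rw [← hq]; simp
      intro h
      exact hρw ⟨q, hq0, h⟩
    have hI : IsIntegral O (j (y • x)) := by
      let g : Algebra.adjoin k {w} →+* O :=
        (j.toRingHom.comp (algebraMap (Algebra.adjoin k {w}) E)).codRestrict O.toSubring (by
          intro a
          change j (a : E) ∈ O
          obtain ⟨q, hq⟩ := hadj a a.2
          rw [← hq]
          have : ((Polynomial.aeval w' q : O) : K) = j (Polynomial.aeval w q) := by
            rw [← Polynomial.aeval_algHom_apply]
            exact (Polynomial.aeval_algHom_apply (O.val.restrictScalars k) w' q).symm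
          exact this ▸ (Polynomial.aeval w' q : O).2)
      exact hy.map_of_comp_eq g j.toRingHom (by ext; rfl)
    obtain ⟨z, hz⟩ := IsIntegrallyClosed.isIntegral_iff.1 hI
    obtain ⟨u, hu⟩ := hyu
    have hx : j x = ((z * ((u⁻¹ : Oˣ) : O) : O) : K) := by
      have h1 : (u : O) * ((u⁻¹ : Oˣ) : O) = 1 := u.mul_inv
      have h2 : (z : K) = (u : O) * j x := by
        rw [hu, hy', ← map_mul]
        exact hz
      have h3 : ((u : O) : K) * (((u⁻¹ : Oˣ) : O) : K) = 1 := congrArg Subtype.val h1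
      push_cast
      rw [h2]
      linear_combination (-(j x)) * h3
    rw [hx]
    exact SetLike.coe_mem _
  exact ⟨ρ.comp (AlgHom.codRestrict j (O.restrictScalars k) hmem)⟩

theorem exists_generator_of_algHom_ratFunc {k E : Type*} [Field k] [Field E] [Algebra k E]
    (ρ : E →ₐ[k] RatFunc k) : ∃ w : E, ∀ x : E, ∃ P Q : Polynomial k,
      x = Polynomial.aeval w P / Polynomial.aeval w Q := by
  have hmem : RatFunc.Luroth.generator ρ.fieldRange ∈ ρ.fieldRange :=
    RatFunc.Luroth.generator_mem
  obtain ⟨w, hw⟩ := hmem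
  refine ⟨w, fun x => ?_⟩
  have hx : ρ x ∈ ρ.fieldRange := ⟨x, rfl⟩
  rw [RatFunc.Luroth.eq_adjoin_generator (E := ρ.fieldRange),
    IntermediateField.mem_adjoin_simple_iff] at hx
  obtain ⟨r, s, h⟩ := hx
  refine ⟨r, s, ρ.injective ?_⟩
  replace hw : ρ w = RatFunc.Luroth.generator ρ.fieldRange := hw
  change ρ x = ρ (Polynomial.aeval w r / Polynomial.aeval w s)
  rw [map_div₀, ← Polynomial.aeval_algHom_apply, ← Polynomial.aeval_algHom_apply, h, hw]

/-- A positive grading of `B`, encoded as the coaction `f ↦ ∑ f_n X ^ n`. -/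
structure IsPosCoaction {k B : Type*} [CommRing k] [CommRing B] [Algebra k B]
    (Φ : B →ₐ[k] Polynomial B) : Prop where
  eval_one : ∀ f, (Φ f).eval 1 = f
  coeff : ∀ f n, Φ ((Φ f).coeff n) = Polynomial.monomial n ((Φ f).coeff n)
  coeff_zero : ∀ f, ∃ c : k, (Φ f).coeff 0 = algebraMap k B c

theorem HasPositiveZGrading.exists_isPosCoaction {k B : Type*} [CommRing k] [CommRing B]
    [Algebra k B] (h : HasPositiveZGrading k B) :
    ∃ Φ : B →ₐ[k] Polynomial B, IsPosCoaction Φ := by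
  obtain ⟨𝒜, ⟨hG⟩, hneg, h0⟩ := h
  have hz : ∀ i < 0, ∀ f ∈ 𝒜 i, f = 0 := fun i hi f hf => by
    rw [hneg i hi] at hf
    simpa using hf
  let ψ : (DirectSum ℤ fun i => 𝒜 i) →ₐ[k] Polynomial B :=
    DirectSum.toAlgebra k (fun i => 𝒜 i)
      (fun i => ((Polynomial.monomial i.toNat).restrictScalars k).comp (𝒜 i).subtype)
      (by simp [Polynomial.monomial_zero_left])
      (by
        rintro i j ⟨f, hf⟩ ⟨g, hg⟩
        simp only [LinearMap.coe_comp, Function.comp_apply, Submodule.subtype_apply,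
          LinearMap.coe_restrictScalars, SetLike.coe_gMul, Polynomial.monomial_mul_monomial]
        rcases lt_or_ge i 0 with hi | hi
        · simp [hz i hi f hf]
        rcases lt_or_ge j 0 with hj | hj
        · simp [hz j hj g hg]
        rw [Int.toNat_add hi hj])
  let Φ : B →ₐ[k] Polynomial B := ψ.comp (DirectSum.decomposeAlgEquiv 𝒜).toAlgHom
  have hΦ : ∀ i (f : 𝒜 i), Φ f = Polynomial.monomial i.toNat (f : B) := fun i f => by
    change ψ (DirectSum.decompose 𝒜 (f : B)) = _
    rw [DirectSum.decompose_coe]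
    exact DirectSum.toModule_lof k
      (φ := fun i => ((Polynomial.monomial i.toNat).restrictScalars k).comp (𝒜 i).subtype) i f
  refine ⟨Φ, fun f => ?_, fun f n => ?_, fun f => ?_⟩
  · induction f using DirectSum.Decomposition.inductionOn 𝒜 with
    | zero => simp
    | homogeneous f => simp [hΦ]
    | add f g hf hg => rw [map_add, Polynomial.eval_add, hf, hg]
  · induction f using DirectSum.Decomposition.inductionOn 𝒜 with
    | zero => simp
    | @homogeneous i f =>
      rw [hΦ, Polynomial.coeff_monomial]
      split_ifs with h
      · rw [hΦ, h]
      · simp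
    | add f g hf hg => rw [map_add, Polynomial.coeff_add, map_add, hf, hg, map_add]
  · induction f using DirectSum.Decomposition.inductionOn 𝒜 with
    | zero => exact ⟨0, by simp⟩
    | @homogeneous i f =>
      rw [hΦ, Polynomial.coeff_monomial]
      split_ifs with h
      · rcases lt_or_ge i 0 with hi | hi
        · exact ⟨0, by rw [hz i hi f f.2, map_zero]⟩
        · obtain rfl : i = 0 := by omega
          have : (f : B) ∈ (1 : Submodule k B) := by rw [← h0]; exact f.2
          rw [Submodule.mem_one] at this
          obtain ⟨c, hc⟩ := this
          exact ⟨c, hc.symm⟩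
      · exact ⟨0, by simp⟩
    | add f g hf hg =>
      obtain ⟨c, hc⟩ := hf
      obtain ⟨c', hc'⟩ := hg
      exact ⟨c + c', by rw [map_add, Polynomial.coeff_add, hc, hc', map_add]⟩

/-- `f` is homogeneous of degree `n` for the coaction `Φ`. -/
def IsHomog {k B : Type*} [CommRing k] [CommRing B] [Algebra k B]
    (Φ : B →ₐ[k] Polynomial B) (n : ℕ) (f : B) : Prop :=
  Φ f = Polynomial.monomial n f

namespace IsHomog

section Ring

variable {k B : Type*} [CommRing k] [CommRing B] [Algebra k B] {Φ : B →ₐ[k] Polynomial B}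
  {n m : ℕ} {f g : B}

theorem mul (hf : IsHomog Φ n f) (hg : IsHomog Φ m g) : IsHomog Φ (n + m) (f * g) := by
  unfold IsHomog at *
  rw [map_mul, hf, hg, Polynomial.monomial_mul_monomial]

theorem of_algebraMap (c : k) : IsHomog Φ 0 (algebraMap k B c) := by
  unfold IsHomog
  rw [AlgHom.commutes, Polynomial.monomial_zero_left]
  rfl

theorem one : IsHomog Φ 0 (1 : B) := by
  simpa using IsHomog.of_algebraMap (Φ := Φ) (1 : k)

theorem pow (hf : IsHomog Φ n f) (r : ℕ) : IsHomog Φ (r * n) (f ^ r) := by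
  unfold IsHomog at *
  rw [map_pow, hf, Polynomial.monomial_pow, mul_comm]

theorem add (hf : IsHomog Φ n f) (hg : IsHomog Φ n g) : IsHomog Φ n (f + g) := by
  unfold IsHomog at *
  rw [map_add, hf, hg, map_add]

theorem sub (hf : IsHomog Φ n f) (hg : IsHomog Φ n g) : IsHomog Φ n (f - g) := by
  unfold IsHomog at *
  rw [map_sub, hf, hg, map_sub]

theorem algebraMap_mul (c : k) (hf : IsHomog Φ n f) :
    IsHomog Φ n (algebraMap k B c * f) := by
  simpa using (IsHomog.of_algebraMap c).mul hf

theorem prod {ι : Type*} (s : Finset ι) {d : ι → ℕ} {p : ι → B} (h : ∀ i, IsHomog Φ (d i) (p i)) :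
    IsHomog Φ (∑ i ∈ s, d i) (∏ i ∈ s, p i) := by
  classical
  induction s using Finset.induction_on with
  | empty => simpa using one
  | insert a s ha ih => rw [Finset.sum_insert ha, Finset.prod_insert ha]; exact (h a).mul ih

theorem degree_unique (hf : IsHomog Φ n f) (hf' : IsHomog Φ m f) (h0 : f ≠ 0) : n = m := by
  have := hf.symm.trans hf'
  rw [Polynomial.monomial_eq_monomial_iff] at this
  simpa [h0] using this

theorem exists_algebraMap (hΦ : IsPosCoaction Φ) (hf : IsHomog Φ 0 f) :
    ∃ c : k, f = algebraMap k B c := by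
  obtain ⟨c, hc⟩ := hΦ.coeff_zero f
  rw [hf] at hc
  exact ⟨c, by simpa using hc⟩

theorem of_mul [IsDomain B] (hΦ : IsPosCoaction Φ) (h0 : f * g ≠ 0) (h : IsHomog Φ n (f * g)) :
    ∃ r s, IsHomog Φ r f ∧ IsHomog Φ s g ∧ r + s = n := by
  have key : ∀ f, (Φ f).natDegree = (Φ f).natTrailingDegree → IsHomog Φ (Φ f).natDegree f := by
    intro f hf
    have h1 : Φ f = Polynomial.monomial (Φ f).natDegree ((Φ f).coeff (Φ f).natDegree) := by
      ext i
      rw [Polynomial.coeff_monomial]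
      split_ifs with hi
      · rw [hi]
      · rcases lt_or_gt_of_ne hi with hi | hi
        · exact Polynomial.coeff_eq_zero_of_natDegree_lt hi
        · exact Polynomial.coeff_eq_zero_of_lt_natTrailingDegree (hf ▸ hi)
    have h2 := hΦ.eval_one f
    rw [h1, Polynomial.eval_monomial, one_pow, mul_one] at h2
    rw [h2] at h1
    exact h1
  have hinj : ∀ f, f ≠ 0 → Φ f ≠ 0 := fun f hf hf' => hf (by rw [← hΦ.eval_one f, hf']; simp)
  have hf := hinj f (left_ne_zero_of_mul h0)
  have hg := hinj g (right_ne_zero_of_mul h0)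
  have hmul : Φ f * Φ g = Polynomial.monomial n (f * g) := by rw [← map_mul]; exact h
  have hd := congrArg Polynomial.natDegree hmul
  have ht := congrArg Polynomial.natTrailingDegree hmul
  rw [Polynomial.natDegree_mul hf hg, Polynomial.natDegree_monomial_eq _ h0] at hd
  rw [Polynomial.natTrailingDegree_mul hf hg, Polynomial.natTrailingDegree_monomial h0] at ht
  have hf' := Polynomial.natTrailingDegree_le_natDegree (Φ f)
  have hg' := Polynomial.natTrailingDegree_le_natDegree (Φ g)
  exact ⟨_, _, key f (by omega), key g (by omega), hd⟩

end Ring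

end IsHomog

theorem IsPosCoaction.sum_coeff {k B : Type*} [CommRing k] [CommRing B] [Algebra k B]
    {Φ : B →ₐ[k] Polynomial B} (hΦ : IsPosCoaction Φ) (f : B) :
    f = ∑ n ∈ (Φ f).support, (Φ f).coeff n := by
  conv_lhs => rw [← hΦ.eval_one f, Polynomial.eval_eq_sum, Polynomial.sum_def]
  simp

theorem IsPosCoaction.isHomog_coeff {k B : Type*} [CommRing k] [CommRing B] [Algebra k B]
    {Φ : B →ₐ[k] Polynomial B} (hΦ : IsPosCoaction Φ) (f : B) (n : ℕ) :
    IsHomog Φ n ((Φ f).coeff n) := hΦ.coeff f n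

section DegreeZeroField

variable {k B : Type*} [Field k] [CommRing B] [IsDomain B] [Algebra k B]
  (K : Type*) [Field K] [Algebra k K] [Algebra B K] [IsScalarTower k B K] [IsFractionRing B K]

/-- The field of fractions `f / g` with `f`, `g` homogeneous of the same degree. -/
def degreeZeroField (Φ : B →ₐ[k] Polynomial B) : IntermediateField k K where
  carrier := {x | ∃ n f g, IsHomog Φ n f ∧ IsHomog Φ n g ∧ g ≠ 0 ∧
    x = algebraMap B K f / algebraMap B K g}
  mul_mem' := by
    rintro _ _ ⟨n, f, g, hf, hg, hg0, rfl⟩ ⟨m, f', g', hf', hg', hg0', rfl⟩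
    exact ⟨n + m, f * f', g * g', hf.mul hf', hg.mul hg', mul_ne_zero hg0 hg0', by
      rw [map_mul, map_mul, div_mul_div_comm]⟩
  add_mem' := by
    rintro _ _ ⟨n, f, g, hf, hg, hg0, rfl⟩ ⟨m, f', g', hf', hg', hg0', rfl⟩
    refine ⟨n + m, f * g' + g * f', g * g', (hf.mul hg').add (hg.mul hf'), hg.mul hg',
      mul_ne_zero hg0 hg0', ?_⟩
    rw [div_add_div _ _ (by simpa using hg0) (by simpa using hg0')]
    simp
  algebraMap_mem' c := ⟨0, algebraMap k B c, 1, .of_algebraMap c, .one, one_ne_zero, by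
    simp [← IsScalarTower.algebraMap_apply]⟩
  inv_mem' := by
    rintro _ ⟨n, f, g, hf, hg, hg0, rfl⟩
    by_cases hf0 : f = 0
    · exact ⟨n, f, g, hf, hg, hg0, by simp [hf0]⟩
    · exact ⟨n, g, f, hg, hf, hf0, by simp⟩

variable {K} {Φ : B →ₐ[k] Polynomial B}

theorem transcendental_degreeZeroField (hΦ : IsPosCoaction Φ) {n : ℕ} (hn : 0 < n) {t : B}
    (ht : IsHomog Φ n t) (ht0 : t ≠ 0) :
    Transcendental (degreeZeroField K Φ) (algebraMap B K t) := by
  let L := RatFunc K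
  let ψ : B →+* L :=
    (algebraMap (Polynomial K) L).comp ((Polynomial.mapRingHom (algebraMap B K)).comp Φ.toRingHom)
  have hψ : Function.Injective ψ := by
    refine (RatFunc.algebraMap_injective K).comp
      ((Polynomial.map_injective _ (IsFractionRing.injective B K)).comp ?_)
    intro f g hfg
    rw [← hΦ.eval_one f, ← hΦ.eval_one g]
    exact congrArg _ hfg
  have hψh : ∀ {m f}, IsHomog Φ m f →
      ψ f = algebraMap (Polynomial K) L (Polynomial.monomial m (algebraMap B K f)) := by
    intro m f hf
    change algebraMap (Polynomial K) L (Polynomial.map (algebraMap B K) (Φ f)) = _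
    rw [hf, Polynomial.map_monomial]
  let Ψ : K →+* L := IsFractionRing.lift hψ
  have hΨB : ∀ f, Ψ (algebraMap B K f) = ψ f := fun f => IsFractionRing.lift_algebraMap hψ f
  have hΨ0 : ∀ x : degreeZeroField K Φ,
      Ψ (x : K) = algebraMap (Polynomial K) L (Polynomial.C (x : K)) := by
    rintro ⟨x, m, f, g, hf, hg, hg0, rfl⟩
    have hgK : algebraMap B K g ≠ 0 := by simpa using hg0
    have hX : Polynomial.monomial m (algebraMap B K g) ≠ 0 := by simpa using hg0
    dsimp only
    rw [map_div₀, hΨB, hΨB, hψh hf, hψh hg, div_eq_iff ((map_ne_zero_iff _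
      (RatFunc.algebraMap_injective K)).2 hX), ← map_mul, Polynomial.C_mul_monomial,
      div_mul_cancel₀ _ hgK]
  rintro ⟨q, hq0, hq⟩
  have h := congrArg Ψ hq
  have hcomp : Ψ (Polynomial.aeval (algebraMap B K t) q) = algebraMap (Polynomial K) L
      ((q.map (algebraMap (degreeZeroField K Φ) K)).comp
        (Polynomial.monomial n (algebraMap B K t))) := by
    rw [Polynomial.aeval_def, Polynomial.hom_eval₂, Polynomial.comp, Polynomial.hom_eval₂,
      Polynomial.eval₂_map, hΨB, hψh ht]
    congr 1
    ext x
    exact hΨ0 x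
  rw [hcomp, map_zero, map_eq_zero_iff _ (RatFunc.algebraMap_injective K),
    Polynomial.comp_eq_zero_iff] at h
  rcases h with h | ⟨-, h⟩
  · exact hq0 ((Polynomial.map_eq_zero_iff (algebraMap (degreeZeroField K Φ) K).injective).1 h)
  · have := congrArg Polynomial.natDegree h
    rw [Polynomial.natDegree_C, Polynomial.natDegree_monomial_eq _ (by simpa using ht0)] at this
    omega

end DegreeZeroField

theorem isAlgebraic_of_mem {k B : Type*} [CommRing k] [CommRing B] [Nontrivial B] [Algebra k B]
    {S : Subalgebra k B} {x : B} (hx : x ∈ S) : IsAlgebraic S x :=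
  isAlgebraic_algebraMap (⟨x, hx⟩ : S)

theorem exists_isHomog_pos {k B : Type*} [Field k] [CommRing B] [IsDomain B] [Algebra k B]
    {Φ : B →ₐ[k] Polynomial B} (hΦ : IsPosCoaction Φ) {s : B} (hs : Transcendental k s) :
    ∃ n > 0, ∃ t, t ≠ 0 ∧ IsHomog Φ n t := by
  by_contra! h
  apply hs
  obtain ⟨c, hc⟩ := hΦ.coeff_zero s
  have : s = algebraMap k B c := by
    rw [hΦ.sum_coeff s, ← hc]
    refine Finset.sum_eq_single 0 (fun n hn hn0 => ?_) (fun h0 => ?_)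
    · by_contra h0
      exact h n (Nat.pos_of_ne_zero hn0) _ h0 (hΦ.isHomog_coeff s n)
    · simpa using h0
  rw [this]
  exact isAlgebraic_algebraMap c

theorem degreeZeroField_ne_bot {k B K : Type*} [Field k] [CommRing B] [IsDomain B] [Algebra k B]
    [Field K] [Algebra k K] [Algebra B K] [IsScalarTower k B K] [IsFractionRing B K]
    {Φ : B →ₐ[k] Polynomial B} (hΦ : IsPosCoaction Φ)
    {s : Fin 2 → B} (hs : AlgebraicIndependent k s) :
    degreeZeroField K Φ ≠ ⊥ := by
  intro hbot
  obtain ⟨n, hn, t, ht0, ht⟩ := exists_isHomog_pos hΦ (hs.transcendental 0)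
  have halg : ∀ m f, IsHomog Φ m f → IsAlgebraic (Algebra.adjoin k {t}) f := by
    intro m f hf
    have hmem : algebraMap B K (f ^ n) / algebraMap B K (t ^ m) ∈ degreeZeroField K Φ :=
      ⟨n * m, f ^ n, t ^ m, hf.pow n, mul_comm m n ▸ ht.pow m, pow_ne_zero _ ht0, rfl⟩
    rw [hbot, IntermediateField.mem_bot] at hmem
    obtain ⟨c, hc⟩ := hmem
    have htK : algebraMap B K (t ^ m) ≠ 0 := by simpa using fun h => absurd h ht0
    rw [eq_div_iff htK, IsScalarTower.algebraMap_apply k B K, ← map_mul] at hc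
    have hc' := IsFractionRing.injective B K hc
    refine IsAlgebraic.of_pow hn ?_
    rw [← hc']
    have hmem : algebraMap k B c * t ^ m ∈ Algebra.adjoin k {t} :=
      mul_mem (algebraMap_mem _ _) (pow_mem (Algebra.subset_adjoin (Set.mem_singleton t)) _)
    exact isAlgebraic_of_mem hmem
  have : Algebra.IsAlgebraic (Algebra.adjoin k {t}) B := ⟨fun f => by
    rw [hΦ.sum_coeff f]
    refine Finset.sum_induction _ (IsAlgebraic (Algebra.adjoin k {t})) (fun _ _ => IsAlgebraic.add)
      isAlgebraic_zero fun i _ => halg i _ (hΦ.isHomog_coeff f i)⟩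
  have h1 := Algebra.IsAlgebraic.trdeg_le_cardinalMk k ({t} : Set B)
  have h2 := hs.lift_cardinalMk_le_trdeg
  have h3 := h2.trans (Cardinal.lift_le.2 h1)
  simp at h3

theorem exists_degreeZeroField_generator {k B K : Type*} [Field k] [IsAlgClosed k]
    [CommRing B] [IsDomain B] [UniqueFactorizationMonoid B] [Algebra k B]
    [Field K] [Algebra k K] [Algebra B K] [IsScalarTower k B K] [IsFractionRing B K]
    {Φ : B →ₐ[k] Polynomial B} (hΦ : IsPosCoaction Φ)
    {s : Fin 2 → B} (hs : AlgebraicIndependent k s)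
    (e : K ≃ₐ[k] FractionRing (MvPolynomial (Fin 2) k)) :
    ∃ w ∈ degreeZeroField K Φ, w ∉ (algebraMap k K).range ∧
      ∀ x ∈ degreeZeroField K Φ, ∃ P Q : Polynomial k,
        x = Polynomial.aeval w P / Polynomial.aeval w Q := by
  have hbot := degreeZeroField_ne_bot (K := K) hΦ hs
  obtain ⟨n, hn, t, ht0, ht⟩ := exists_isHomog_pos hΦ (hs.transcendental 0)
  obtain ⟨w, hw⟩ : ∃ w : degreeZeroField K Φ, Transcendental k w := by
    by_contra! h
    apply hbot
    have : Algebra.IsAlgebraic k (degreeZeroField K Φ) :=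
      ⟨fun x => by simpa [Transcendental] using h x⟩
    exact IntermediateField.eq_bot_of_isAlgClosed_of_isAlgebraic _
  have htr : Algebra.trdeg k (degreeZeroField K Φ) ≤ 1 := by
    have h2 : Algebra.trdeg k K = 2 := by
      have h3 := e.lift_trdeg_eq
      have h4 := trdeg_add_eq k (MvPolynomial (Fin 2) k)
        (A := FractionRing (MvPolynomial (Fin 2) k))
      have h5 : Algebra.IsAlgebraic (MvPolynomial (Fin 2) k)
          (FractionRing (MvPolynomial (Fin 2) k)) :=
        IsLocalization.isAlgebraic _ (nonZeroDivisors _)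
      rw [trdeg_eq_zero (R := MvPolynomial (Fin 2) k), add_zero,
        MvPolynomial.trdeg_of_isDomain] at h4
      rw [← h4] at h3
      simpa using h3
    have h3 := trdeg_add_eq k (degreeZeroField K Φ) (A := K)
    have : Algebra.Transcendental (degreeZeroField K Φ) K :=
      ⟨_, transcendental_degreeZeroField hΦ hn ht ht0⟩
    have h4 := trdeg_pos (degreeZeroField K Φ) K
    have h5 := Cardinal.one_le_iff_pos.2 h4
    rw [h2] at h3
    have h6 : Algebra.trdeg k (degreeZeroField K Φ) + 1 ≤ 1 + 1 := by
      calc _ ≤ _ := add_le_add_right h5 _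
        _ = 2 := h3
        _ = 1 + 1 := one_add_one_eq_two.symm
    exact Cardinal.add_one_le_add_one_iff.1 h6
  have hind : AlgebraicIndependent k (fun _ : Unit => w) := by
    rwa [algebraicIndependent_unique_type_iff]
  have hbasis :=
    AlgebraicIndependent.isTranscendenceBasis_of_lift_trdeg_le_of_finite hind (by simpa using htr)
  have halg := hbasis.isAlgebraic
  rw [Set.range_const] at halg
  obtain ⟨ρ⟩ := nonempty_algHom_ratFunc (K := FractionRing (MvPolynomial (Fin 2) k))
    (e.toAlgHom.comp (degreeZeroField K Φ).val) hw
  obtain ⟨v, hv⟩ := exists_generator_of_algHom_ratFunc ρ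
  have hv' : ∀ x ∈ degreeZeroField K Φ, ∃ P Q : Polynomial k,
        x = Polynomial.aeval (v : K) P / Polynomial.aeval (v : K) Q := by
    intro x hx
    obtain ⟨P, Q, h⟩ := hv ⟨x, hx⟩
    refine ⟨P, Q, ?_⟩
    have := congrArg (degreeZeroField K Φ).val h
    rw [map_div₀, ← Polynomial.aeval_algHom_apply, ← Polynomial.aeval_algHom_apply] at this
    exact this
  refine ⟨v, v.2, ?_, hv'⟩
  rintro ⟨c, hc⟩
  apply hbot
  rw [eq_bot_iff]
  intro x hx
  obtain ⟨P, Q, h⟩ := hv' x hx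
  rw [h, ← hc, Polynomial.aeval_algebraMap_apply, Polynomial.aeval_algebraMap_apply, ← map_div₀]
  exact IntermediateField.algebraMap_mem _ _

theorem exists_coprime_generators {k B K : Type*} [Field k] [IsAlgClosed k]
    [CommRing B] [IsDomain B] [UniqueFactorizationMonoid B] [Algebra k B]
    [Field K] [Algebra k K] [Algebra B K] [IsScalarTower k B K] [IsFractionRing B K]
    {Φ : B →ₐ[k] Polynomial B} (hΦ : IsPosCoaction Φ)
    {s : Fin 2 → B} (hs : AlgebraicIndependent k s)
    (e : K ≃ₐ[k] FractionRing (MvPolynomial (Fin 2) k)) :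
    ∃ d > 0, ∃ A C : B, IsHomog Φ d A ∧ IsHomog Φ d C ∧ IsRelPrime A C ∧ C ≠ 0 ∧
      ∀ n f g, IsHomog Φ n f → IsHomog Φ n g → g ≠ 0 → ∃ P Q : Polynomial k,
        algebraMap B K f / algebraMap B K g =
          Polynomial.aeval (algebraMap B K A / algebraMap B K C) P /
          Polynomial.aeval (algebraMap B K A / algebraMap B K C) Q := by
  obtain ⟨w, ⟨d, A, C, hA, hC, hC0, rfl⟩, hwk, hgen⟩ := exists_degreeZeroField_generator hΦ hs e
  have hA0 : A ≠ 0 := by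
    rintro rfl
    exact hwk ⟨0, by simp⟩
  obtain ⟨A', C', b, hrel, rfl, rfl⟩ := UniqueFactorizationMonoid.exists_reduced_factors A hA0 C
  obtain ⟨r, d', hr, hA', h1⟩ := IsHomog.of_mul hΦ hA0 hA
  obtain ⟨r', d'', hr', hC', h2⟩ := IsHomog.of_mul hΦ hC0 hC
  have hb0 := left_ne_zero_of_mul hA0
  obtain rfl := hr.degree_unique hr' hb0
  obtain rfl : d' = d'' := by omega
  have hbK : algebraMap B K b ≠ 0 := by simpa using hb0
  rw [map_mul, map_mul, mul_div_mul_left _ _ hbK] at hgen hwk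
  refine ⟨d', Nat.pos_of_ne_zero ?_, A', C', hA', hC', hrel, right_ne_zero_of_mul hC0,
    fun n f g hf hg hg0 => hgen _ ⟨n, f, g, hf, hg, hg0, rfl⟩⟩
  rintro rfl
  obtain ⟨x, rfl⟩ := hA'.exists_algebraMap hΦ
  obtain ⟨y, rfl⟩ := hC'.exists_algebraMap hΦ
  exact hwk ⟨x / y, by simp [← IsScalarTower.algebraMap_apply]⟩

theorem IsHomog.not_isUnit {k B : Type*} [Field k] [CommRing B] [IsDomain B] [Algebra k B]
    {Φ : B →ₐ[k] Polynomial B} (hΦ : IsPosCoaction Φ) {n : ℕ} {f : B} (hf : IsHomog Φ n f)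
    (hn : 0 < n) : ¬ IsUnit f := by
  intro hu
  obtain ⟨g, hg⟩ := hu.exists_right_inv
  have h1 : IsHomog Φ 0 (f * g) := hg ▸ .one
  obtain ⟨r, s, hr, -, hrs⟩ := IsHomog.of_mul hΦ (by rw [hg]; exact one_ne_zero) h1
  have := hf.degree_unique hr hu.ne_zero
  omega

/-- A pencil of coprime homogeneous elements of degree `d`, indexed by the points of the
projective line over `k`, through which all homogeneous elements factor up to quotients. -/
structure IsPencil {k B : Type*} [Field k] [CommRing B] [Algebra k B]
    (Φ : B →ₐ[k] Polynomial B) (d : ℕ) (L : Option k → B) : Prop where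
  pos : 0 < d
  isHomog : ∀ P, IsHomog Φ d (L P)
  ne_zero : ∀ P, L P ≠ 0
  isRelPrime : ∀ P Q, P ≠ Q → IsRelPrime (L P) (L Q)
  exists_eq : ∀ P Q R, P ≠ Q → R ≠ P → R ≠ Q → ∃ s t : k, s ≠ 0 ∧ t ≠ 0 ∧
    L R = algebraMap k B s * L P + algebraMap k B t * L Q
  exists_mul_eq : ∀ n f g, IsHomog Φ n f → IsHomog Φ n g → f ≠ 0 → g ≠ 0 →
    ∃ (s t : Multiset (Option k)) (c : k), c ≠ 0 ∧
      f * (s.map L).prod * algebraMap k B c = g * (t.map L).prod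

/-- The element of the pencil spanned by `a` and `c` vanishing at a given point. -/
def linearForm {k B : Type*} [Field k] [CommRing B] [Algebra k B] (a c : B) : Option k → B
  | none => c
  | some x => a - algebraMap k B x * c

theorem exists_aeval_mul_prod_linearForm {k B K : Type*} [Field k] [IsAlgClosed k]
    [CommRing B] [Algebra k B] [Field K] [Algebra k K] [Algebra B K] [IsScalarTower k B K]
    {a c : B} (hc : algebraMap B K c ≠ 0) {P : Polynomial k} (hP : P ≠ 0) :
    ∃ (s t : Multiset (Option k)) (x : k), x ≠ 0 ∧
      Polynomial.aeval (algebraMap B K a / algebraMap B K c) P *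
        algebraMap B K (s.map (linearForm a c)).prod =
      algebraMap k K x * algebraMap B K (t.map (linearForm a c)).prod := by
  refine ⟨Multiset.replicate P.roots.card none, P.roots.map some, P.leadingCoeff,
    Polynomial.leadingCoeff_ne_zero.2 hP, ?_⟩
  have hroots := congrArg (Polynomial.aeval (algebraMap B K a / algebraMap B K c))
    (IsAlgClosed.splits P).eq_prod_roots
  rw [hroots, map_mul, Polynomial.aeval_C, mul_assoc]
  congr 1
  induction P.roots using Multiset.induction_on with
  | empty => simp
  | cons r m ih =>
    rw [Multiset.map_cons, Multiset.prod_cons, Multiset.card_cons, Multiset.replicate_succ,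
      Multiset.map_cons, Multiset.prod_cons, Multiset.map_cons, Multiset.map_cons,
      Multiset.prod_cons, map_mul, map_mul, map_mul, ← ih]
    simp only [linearForm, map_sub, map_mul, Polynomial.aeval_X, Polynomial.aeval_C,
      ← IsScalarTower.algebraMap_apply]
    field_simp

theorem exists_linearForm_combination {k B : Type*} [Field k] [CommRing B] [Algebra k B]
    (a c : B) {P Q : Option k} (h : P ≠ Q) :
    (∃ s t : k, a = algebraMap k B s * linearForm a c P + algebraMap k B t * linearForm a c Q) ∧
    ∃ s t : k, c = algebraMap k B s * linearForm a c P + algebraMap k B t * linearForm a c Q := by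
  rcases P with _ | x <;> rcases Q with _ | y
  · exact absurd rfl h
  · exact ⟨⟨y, 1, by simp [linearForm]⟩, 1, 0, by simp [linearForm]⟩
  · exact ⟨⟨1, x, by simp [linearForm]⟩, 0, 1, by simp [linearForm]⟩
  · have hxy : y - x ≠ 0 := sub_ne_zero.2 fun hh => h (by rw [hh])
    have h1 : algebraMap k B (y - x)⁻¹ * (algebraMap k B y - algebraMap k B x) = 1 := by
      rw [← map_sub, ← map_mul, inv_mul_cancel₀ hxy, map_one]
    refine ⟨⟨(y - x)⁻¹ * y, - ((y - x)⁻¹ * x), ?_⟩, (y - x)⁻¹, -(y - x)⁻¹, ?_⟩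
    · simp only [linearForm, map_mul, map_neg]
      linear_combination (- a) * h1
    · simp only [linearForm, map_neg]
      linear_combination (- c) * h1

theorem exists_isPencil {k B K : Type*} [Field k] [IsAlgClosed k]
    [CommRing B] [IsDomain B] [UniqueFactorizationMonoid B] [Algebra k B]
    [Field K] [Algebra k K] [Algebra B K] [IsScalarTower k B K] [IsFractionRing B K]
    {Φ : B →ₐ[k] Polynomial B} (hΦ : IsPosCoaction Φ)
    {s : Fin 2 → B} (hs : AlgebraicIndependent k s)
    (e : K ≃ₐ[k] FractionRing (MvPolynomial (Fin 2) k)) :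
    ∃ d L, IsPencil Φ d L := by
  obtain ⟨d, hd, a, c, ha, hc, hac, hc0, hgen⟩ := exists_coprime_generators hΦ hs e
  have hhom : ∀ P : Option k, IsHomog Φ d (linearForm a c P)
    | none => hc
    | some x => ha.sub (.algebraMap_mul x hc)
  have hrel : ∀ P Q : Option k, P ≠ Q → IsRelPrime (linearForm a c P) (linearForm a c Q) := by
    intro P Q hPQ u hP hQ
    obtain ⟨⟨s, t, h1⟩, s', t', h2⟩ := exists_linearForm_combination a c hPQ
    apply hac
    · rw [h1]
      exact dvd_add (hP.mul_left _) (hQ.mul_left _)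
    · rw [h2]
      exact dvd_add (hP.mul_left _) (hQ.mul_left _)
  have hunit : ∀ P : Option k, ¬ IsUnit (linearForm a c P) := fun P => (hhom P).not_isUnit hΦ hd
  have hne : ∀ P : Option k, linearForm a c P ≠ 0 := by
    rintro (_ | x) h0
    · exact hc0 h0
    · exact hunit none (hrel none (some x) (by simp) dvd_rfl (h0 ▸ dvd_zero _))
  have hspan : ∀ R : Option k, ∃ s t : k,
      linearForm a c R = algebraMap k B s * a + algebraMap k B t * c
    | none => ⟨0, 1, by simp [linearForm]⟩
    | some x => ⟨1, -x, by simp [linearForm, sub_eq_add_neg]⟩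
  refine ⟨d, linearForm a c, hd, hhom, hne, hrel, ?_, ?_⟩
  · intro P Q R hPQ hRP hRQ
    obtain ⟨⟨s, t, h1⟩, s', t', h2⟩ := exists_linearForm_combination a c hPQ
    obtain ⟨u, v, h3⟩ := hspan R
    have h4 : linearForm a c R = algebraMap k B (u * s + v * s') * linearForm a c P +
        algebraMap k B (u * t + v * t') * linearForm a c Q := by
      simp only [map_add, map_mul]
      linear_combination h3 + algebraMap k B u * h1 + algebraMap k B v * h2
    refine ⟨_, _, ?_, ?_, h4⟩
    · intro h0
      rw [h0, map_zero, zero_mul, zero_add] at h4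
      exact hunit Q (hrel R Q hRQ (h4 ▸ dvd_mul_left _ _) dvd_rfl)
    · intro h0
      rw [h0, map_zero, zero_mul, add_zero] at h4
      exact hunit P (hrel R P hRP (h4 ▸ dvd_mul_left _ _) dvd_rfl)
  · intro n f g hf hg hf0 hg0
    obtain ⟨P, Q, h⟩ := hgen n f g hf hg hg0
    have hinj := IsFractionRing.injective B K
    have hfK : algebraMap B K f ≠ 0 := by simpa using hf0
    have hgK : algebraMap B K g ≠ 0 := by simpa using hg0
    have hcK : algebraMap B K c ≠ 0 := by simpa using hc0
    have hdiv := div_ne_zero hfK hgK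
    rw [h] at hdiv
    obtain ⟨hP, hQ⟩ := div_ne_zero_iff.1 hdiv
    obtain ⟨s, t, x, hx, h1⟩ := exists_aeval_mul_prod_linearForm hcK
      (P := P) (fun h0 => hP (by rw [h0, map_zero]))
    obtain ⟨s', t', x', hx', h2⟩ := exists_aeval_mul_prod_linearForm hcK
      (P := Q) (fun h0 => hQ (by rw [h0, map_zero]))
    refine ⟨t' + s, t + s', x' / x, div_ne_zero hx' hx, hinj ?_⟩
    have hxK : algebraMap k K x ≠ 0 := by simpa using hx
    rw [div_eq_div_iff hgK hQ] at h
    simp only [Multiset.map_add, Multiset.prod_add, map_mul, ← IsScalarTower.algebraMap_apply,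
      map_div₀]
    field_simp
    linear_combination (-algebraMap B K f * algebraMap B K (s.map (linearForm a c)).prod) * h2 +
      (algebraMap B K g * algebraMap B K (s'.map (linearForm a c)).prod) * h1 +
      (algebraMap B K (s.map (linearForm a c)).prod *
        algebraMap B K (s'.map (linearForm a c)).prod) * h

theorem IsHomog.of_dvd {k B : Type*} [CommRing k] [CommRing B] [IsDomain B] [Algebra k B]
    {Φ : B →ₐ[k] Polynomial B} (hΦ : IsPosCoaction Φ) {n : ℕ} {f g : B} (hg : IsHomog Φ n g)
    (hg0 : g ≠ 0) (h : f ∣ g) : ∃ r, IsHomog Φ r f := by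
  obtain ⟨u, rfl⟩ := h
  obtain ⟨r, -, hr, -⟩ := IsHomog.of_mul hΦ hg0 hg
  exact ⟨r, hr⟩

theorem IsHomog.pos_of_not_isUnit {k B : Type*} [Field k] [CommRing B] [Algebra k B]
    {Φ : B →ₐ[k] Polynomial B} (hΦ : IsPosCoaction Φ) {n : ℕ} {f : B} (hf : IsHomog Φ n f)
    (h0 : f ≠ 0) (hu : ¬ IsUnit f) : 0 < n := by
  rcases Nat.eq_zero_or_pos n with rfl | hn
  · obtain ⟨c, rfl⟩ := hf.exists_algebraMap hΦ
    refine absurd ((IsUnit.mk0 c ?_).map (algebraMap k B)) hu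
    rintro rfl
    simp at h0
  · exact hn

theorem multiplicity_mul_of_prime {B : Type*} [CommRing B] [IsDomain B]
    [UniqueFactorizationMonoid B] {p f g : B} (hp : Prime p) (hf : f ≠ 0) (hg : g ≠ 0) :
    multiplicity p (f * g) = multiplicity p f + multiplicity p g :=
  multiplicity_mul hp (.of_not_isUnit hp.not_isUnit (mul_ne_zero hf hg))

namespace IsPencil

variable {k B : Type*} [Field k] [CommRing B] [IsDomain B] [Algebra k B]
  {Φ : B →ₐ[k] Polynomial B} {d : ℕ} {L : Option k → B}

theorem prod_ne_zero (hL : IsPencil Φ d L) (s : Multiset (Option k)) : (s.map L).prod ≠ 0 := by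
  refine Multiset.prod_ne_zero fun h => ?_
  obtain ⟨P, -, hP⟩ := Multiset.mem_map.1 h
  exact hL.ne_zero P hP

theorem exists_dvd (hL : IsPencil Φ d L) {p : B} {n : ℕ} (hp : Prime p)
    (hn : IsHomog Φ n p) : ∃ P, p ∣ L P := by
  obtain ⟨s, t, c, hc, h⟩ := hL.exists_mul_eq _ _ _ (hn.pow d)
    (mul_comm n d ▸ (hL.isHomog none).pow n)
    (pow_ne_zero _ hp.ne_zero) (pow_ne_zero _ (hL.ne_zero none))
  have h1 : p ∣ L none ^ n * (t.map L).prod := by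
    rw [← h, mul_assoc]
    exact (dvd_pow_self p hL.pos.ne').mul_right _
  rcases hp.dvd_or_dvd h1 with h2 | h2
  · exact ⟨none, hp.dvd_of_dvd_pow h2⟩
  · obtain ⟨P, -, hP⟩ := hp.exists_mem_multiset_map_dvd h2
    exact ⟨P, hP⟩

variable [UniqueFactorizationMonoid B]

theorem multiplicity_prod [DecidableEq (Option k)] (hL : IsPencil Φ d L) {P : Option k}
    {p : B} (hp : Prime p) (hpP : p ∣ L P) (s : Multiset (Option k)) :
    multiplicity p (s.map L).prod = s.count P * multiplicity p (L P) := by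
  induction s using Multiset.induction_on with
  | empty => simpa using multiplicity_of_isUnit_right hp.not_isUnit isUnit_one
  | cons Q s ih =>
    rw [Multiset.map_cons, Multiset.prod_cons,
      multiplicity_mul_of_prime hp (hL.ne_zero Q) (hL.prod_ne_zero s), ih]
    by_cases h : P = Q
    · subst h
      rw [Multiset.count_cons_self]
      ring
    · rw [Multiset.count_cons_of_ne h, multiplicity_eq_zero.2, zero_add]
      exact fun hpQ => hp.not_isUnit (hL.isRelPrime P Q h hpP hpQ)

theorem exists_multiplicity (hL : IsPencil Φ d L) {n : ℕ} {f g : B} (hf : IsHomog Φ n f)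
    (hg : IsHomog Φ n g) (hf0 : f ≠ 0) (hg0 : g ≠ 0) :
    ∃ i j : Option k → ℕ, ∀ P p, Prime p → p ∣ L P →
      multiplicity p f + i P * multiplicity p (L P) =
        multiplicity p g + j P * multiplicity p (L P) := by
  classical
  obtain ⟨s, t, c, hc, h⟩ := hL.exists_mul_eq n f g hf hg hf0 hg0
  refine ⟨fun P => s.count P, fun P => t.count P, fun P p hp hpP => ?_⟩
  have hu : IsUnit (algebraMap k B c) := (IsUnit.mk0 c hc).map (algebraMap k B)
  have h' := congrArg (multiplicity p) h
  rwa [multiplicity_mul_of_prime hp (mul_ne_zero hf0 (hL.prod_ne_zero s)) hu.ne_zero,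
    multiplicity_mul_of_prime hp hf0 (hL.prod_ne_zero s),
    multiplicity_mul_of_prime hp hg0 (hL.prod_ne_zero t),
    multiplicity_of_isUnit_right hp.not_isUnit hu,
    add_zero, hL.multiplicity_prod hp hpP, hL.multiplicity_prod hp hpP] at h'

theorem associated_of_dvd (hΦ : IsPosCoaction Φ) (hL : IsPencil Φ d L) {P : Option k} {p q : B}
    (hp : Prime p) (hq : Prime q) (hpP : p ∣ L P) (hqP : q ∣ L P) : Associated p q := by
  by_contra hpq
  obtain ⟨m, hm⟩ := (hL.isHomog P).of_dvd hΦ (hL.ne_zero P) hpP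
  obtain ⟨n, hn⟩ := (hL.isHomog P).of_dvd hΦ (hL.ne_zero P) hqP
  have hm0 := hm.pos_of_not_isUnit hΦ hp.ne_zero hp.not_isUnit
  have hn0 := hn.pos_of_not_isUnit hΦ hq.ne_zero hq.not_isUnit
  obtain ⟨i, j, h⟩ := hL.exists_multiplicity (hm.pow n) (mul_comm m n ▸ hn.pow m)
    (pow_ne_zero _ hp.ne_zero) (pow_ne_zero _ hq.ne_zero)
  have h1 := h P p hp hpP
  have h2 := h P q hq hqP
  have h3 : multiplicity p (q ^ m) = 0 := multiplicity_eq_zero.2 fun hh =>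
    hpq ((hp.dvd_prime_iff_associated hq).1 (hp.dvd_of_dvd_pow hh))
  have h4 : multiplicity q (p ^ n) = 0 := multiplicity_eq_zero.2 fun hh =>
    hpq ((hq.dvd_prime_iff_associated hp).1 (hq.dvd_of_dvd_pow hh)).symm
  rw [multiplicity_pow_self hp.ne_zero hp.not_isUnit, h3] at h1
  rw [multiplicity_pow_self hq.ne_zero hq.not_isUnit, h4] at h2
  rcases le_total (i P) (j P) with hij | hij
  · have := Nat.mul_le_mul_right (multiplicity q (L P)) hij
    omega
  · have := Nat.mul_le_mul_right (multiplicity p (L P)) hij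
    omega

theorem exists_eq_prime_pow [IsAlgClosed k] (hΦ : IsPosCoaction Φ) (hL : IsPencil Φ d L)
    (P : Option k) : ∃ p, Prime p ∧ ∃ e > 0, L P = p ^ e := by
  obtain ⟨p, hp, hpP⟩ := WfDvdMonoid.exists_irreducible_factor
    ((hL.isHomog P).not_isUnit hΦ hL.pos) (hL.ne_zero P)
  rw [irreducible_iff_prime] at hp
  obtain ⟨u, hu, hpu⟩ := (FiniteMultiplicity.of_not_isUnit hp.not_isUnit
    (hL.ne_zero P)).exists_eq_pow_mul_and_not_dvd
  set e := multiplicity p (L P) with he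
  have he0 : 0 < e := Nat.pos_of_ne_zero fun h0 => multiplicity_eq_zero.1 (he.symm.trans h0) hpP
  have hu0 : u ≠ 0 := by
    rintro rfl
    exact hpu (dvd_zero _)
  have huP : u ∣ L P := hu ▸ dvd_mul_left _ _
  have huu : IsUnit u := by
    by_contra huu
    obtain ⟨q, hq, hqu⟩ := WfDvdMonoid.exists_irreducible_factor huu hu0
    rw [irreducible_iff_prime] at hq
    exact hpu ((hL.associated_of_dvd hΦ hp hq hpP (hqu.trans huP)).dvd.trans hqu)
  obtain ⟨r, hr⟩ := (hL.isHomog P).of_dvd hΦ (hL.ne_zero P) huP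
  obtain rfl : r = 0 := by
    by_contra h0
    exact hr.not_isUnit hΦ (Nat.pos_of_ne_zero h0) huu
  obtain ⟨x, rfl⟩ := hr.exists_algebraMap hΦ
  obtain ⟨y, rfl⟩ := IsAlgClosed.exists_pow_nat_eq x he0
  rw [map_pow] at hu huu
  have hy := (isUnit_pow_iff he0.ne').1 huu
  refine ⟨p * algebraMap k B y, ?_, e, he0, by rw [mul_pow]; exact hu⟩
  exact (associated_mul_unit_left p _ hy).symm.prime hp

end IsPencil

/-- A pencil whose members are powers `p P ^ e P` of homogeneous primes, with pairwise coprime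
exponents. -/
structure IsPrimePencil {k B : Type*} [Field k] [CommRing B] [Algebra k B]
    (Φ : B →ₐ[k] Polynomial B) (d : ℕ) (p : Option k → B) (e : Option k → ℕ) : Prop where
  isPencil : IsPencil Φ d fun P => p P ^ e P
  prime : ∀ P, Prime (p P)
  exponent_pos : ∀ P, 0 < e P
  exists_isHomog : ∀ P, ∃ n > 0, IsHomog Φ n (p P) ∧ e P * n = d
  coprime : ∀ P Q, P ≠ Q → (e P).Coprime (e Q)
  not_dvd : ∀ P Q, P ≠ Q → ¬ p P ∣ p Q
  exists_associated : ∀ n f, Prime f → IsHomog Φ n f → ∃ P, Associated f (p P)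
  modEq : ∀ n f g, IsHomog Φ n f → IsHomog Φ n g → f ≠ 0 → g ≠ 0 →
    ∀ P, multiplicity (p P) f ≡ multiplicity (p P) g [MOD e P]

theorem IsPencil.exists_isPrimePencil {k B : Type*} [Field k] [IsAlgClosed k] [CommRing B]
    [IsDomain B] [UniqueFactorizationMonoid B] [Algebra k B] {Φ : B →ₐ[k] Polynomial B} {d : ℕ}
    {L : Option k → B} (hΦ : IsPosCoaction Φ) (hL : IsPencil Φ d L) :
    ∃ p e, IsPrimePencil Φ d p e := by
  choose p hp e he hLp using hL.exists_eq_prime_pow hΦ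
  obtain rfl : L = fun P => p P ^ e P := funext hLp
  have hdvd : ∀ P, p P ∣ p P ^ e P := fun P => dvd_pow_self _ (he P).ne'
  have hmod : ∀ n f g, IsHomog Φ n f → IsHomog Φ n g → f ≠ 0 → g ≠ 0 →
      ∀ P, multiplicity (p P) f ≡ multiplicity (p P) g [MOD e P] := by
    intro n f g hf hg hf0 hg0 P
    obtain ⟨i, j, h⟩ := hL.exists_multiplicity hf hg hf0 hg0
    have h1 := h P (p P) (hp P) (hdvd P)
    rw [multiplicity_pow_self (hp P).ne_zero (hp P).not_isUnit] at h1
    have h2 : _ % e P = _ % e P := congrArg (· % e P) h1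
    rwa [Nat.add_mul_mod_self_right, Nat.add_mul_mod_self_right] at h2
  have hhom : ∀ P, ∃ n > 0, IsHomog Φ n (p P) ∧ e P * n = d := by
    intro P
    obtain ⟨n, hn⟩ := (hL.isHomog P).of_dvd hΦ (hL.ne_zero P) (hdvd P)
    exact ⟨n, hn.pos_of_not_isUnit hΦ (hp P).ne_zero (hp P).not_isUnit, hn,
      (hn.pow _).degree_unique (hL.isHomog P) (hL.ne_zero P)⟩
  have hndvd : ∀ P Q, P ≠ Q → ¬ p P ∣ p Q := fun P Q h hPQ =>
    (hp P).not_isUnit (hL.isRelPrime P Q h (hdvd P) (hPQ.trans (hdvd Q)))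
  refine ⟨p, e, hL, hp, he, hhom, ?_, hndvd, ?_, hmod⟩
  · intro P Q hPQ
    by_contra h
    obtain ⟨l, hl, ⟨a, ha⟩, ⟨b, hb⟩⟩ := Nat.Prime.not_coprime_iff_dvd.1 h
    obtain ⟨m, -, hm, hmd⟩ := hhom P
    obtain ⟨n, -, hn, hnd⟩ := hhom Q
    have hmn : b * n = a * m := by
      refine Nat.eq_of_mul_eq_mul_left hl.pos ?_
      rw [← mul_assoc, ← mul_assoc, ← ha, ← hb, hmd, hnd]
    have h1 := hmod _ _ _ (hm.pow a) (hmn ▸ hn.pow b) (pow_ne_zero _ (hp P).ne_zero)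
      (pow_ne_zero _ (hp Q).ne_zero) P
    rw [multiplicity_pow_self (hp P).ne_zero (hp P).not_isUnit, multiplicity_eq_zero.2
      fun hh => hndvd P Q hPQ ((hp P).dvd_of_dvd_pow hh), Nat.modEq_zero_iff_dvd, ha] at h1
    have ha0 : 0 < a := Nat.pos_of_ne_zero fun h0 => by
      have := he P
      simp [ha, h0] at this
    have h2 := Nat.le_of_dvd ha0 h1
    have h3 := Nat.mul_le_mul_right a hl.two_le
    omega
  · intro n f hf hn
    obtain ⟨P, hP⟩ := hL.exists_dvd hf hn
    exact ⟨P, hL.associated_of_dvd hΦ hf (hp P) hP (hdvd P)⟩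

/-- The exponents of the monomials of degree less than `c i` in the variable `z_i`. -/
def reducedExponents {n : ℕ} (c : Fin n → ℕ) : Set (Fin (n + 2) →₀ ℕ) :=
  {m | ∀ i : Fin n, m i.succ.succ < c i}

theorem mem_restrictSupport_reducedExponents_sup {k : Type*} [Field k] {n a b : ℕ} {c : Fin n → ℕ}
    (lam : Fin n → k) (hc : ∀ i, 0 < c i) (f : MvPolynomial (Fin (n + 2)) k) :
    f ∈ restrictSupport k (reducedExponents c) ⊔
      (Ideal.span (Set.range fun i : Fin n => (X 0 : MvPolynomial (Fin (n + 2)) k) ^ a +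
        C (lam i) * X 1 ^ b + X i.succ.succ ^ c i)).restrictScalars k := by
  set I := Ideal.span (Set.range fun i : Fin n => (X 0 : MvPolynomial (Fin (n + 2)) k) ^ a +
        C (lam i) * X 1 ^ b + X i.succ.succ ^ c i) with hI
  suffices h : ∀ (N : ℕ) (m : Fin (n + 2) →₀ ℕ) (r : k), ∑ i : Fin n, m i.succ.succ = N →
      monomial m r ∈ restrictSupport k (reducedExponents c) ⊔ I.restrictScalars k by
    rw [f.as_sum]
    exact Submodule.sum_mem _ fun m _ => h _ m _ rfl
  intro N
  induction N using Nat.strong_induction_on with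
  | _ N ih =>
    intro m r hm
    by_cases hmR : m ∈ reducedExponents c
    · exact Submodule.mem_sup_left ((monomial_mem_restrictSupport k).2 (Or.inl hmR))
    obtain ⟨i, hi⟩ : ∃ i : Fin n, c i ≤ m i.succ.succ := by simpa [reducedExponents] using hmR
    obtain ⟨m', rfl⟩ := exists_add_of_le (Finsupp.single_le_iff.2 hi)
    have hlt : ∑ j : Fin n, m' j.succ.succ < N := by
      rw [← hm]
      refine Finset.sum_lt_sum (fun j _ => by simp) ⟨i, Finset.mem_univ _, ?_⟩
      simpa using hc i
    have h0 := ih _ hlt (Finsupp.single 0 a + m') r (by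
      refine Finset.sum_congr rfl fun j _ => ?_
      simp)
    have h1 := ih _ hlt (Finsupp.single 1 b + m') (lam i * r) (by
      refine Finset.sum_congr rfl fun j _ => ?_
      have : (1 : Fin (n + 2)) ≠ j.succ.succ := fun h =>
        (Fin.succ_ne_zero j).symm (Fin.succ_injective _ (by simpa using h))
      simp [this])
    have h2 : ((X 0 : MvPolynomial (Fin (n + 2)) k) ^ a + C (lam i) * X 1 ^ b +
        X i.succ.succ ^ c i) * monomial m' r ∈ I.restrictScalars k :=
      I.mul_mem_right _ (Ideal.subset_span ⟨i, rfl⟩)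
    have h3 := Submodule.sub_mem _ (Submodule.mem_sup_right
      (S := restrictSupport k (reducedExponents c)) h2) (Submodule.add_mem _ h0 h1)
    convert h3 using 1
    have hX : ∀ (j : Fin (n + 2)) (t : ℕ) (r : k),
        monomial (Finsupp.single j t + m') r = X j ^ t * monomial m' r := fun j t r => by
      rw [X_pow_eq_monomial, monomial_mul, one_mul]
    rw [hX, hX, hX, ← C_mul_monomial]
    ring

theorem eq_zero_of_aeval_eq_zero_of_mem_restrictSupport {k B : Type*} [Field k] [CommRing B]
    [IsDomain B] [Algebra k B] {Φ : B →ₐ[k] Polynomial B} {n : ℕ} {c : Fin n → ℕ}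
    {q : Fin (n + 2) → B} {d : Fin (n + 2) → ℕ} (hq : ∀ i, Prime (q i))
    (hhom : ∀ i, IsHomog Φ (d i) (q i)) (hd : ∀ i, 0 < d i)
    (hdvd : ∀ i j, i ≠ j → ¬ q i ∣ q j)
    (hmod : ∀ m m' : Fin (n + 2) →₀ ℕ, ∑ i, m i * d i = ∑ i, m' i * d i →
      ∀ i : Fin n, m i.succ.succ ≡ m' i.succ.succ [MOD c i])
    {g : MvPolynomial (Fin (n + 2)) k} (hg : g ∈ restrictSupport k (reducedExponents c))
    (h : aeval q g = 0) : g = 0 := by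
  by_contra hg0
  obtain ⟨m₀, hm₀⟩ := support_nonempty.2 hg0
  have hΦ : ∀ m : Fin (n + 2) →₀ ℕ, ∀ r : k, IsHomog Φ (∑ i, m i * d i)
      (algebraMap k B r * ∏ i, q i ^ m i) := fun m r =>
    .algebraMap_mul r (.prod _ fun i => (hhom i).pow (m i))
  have hexp : aeval q g = ∑ m ∈ g.support, algebraMap k B (g.coeff m) * ∏ i, q i ^ m i := by
    rw [aeval_def, eval₂_eq']
  set T := g.support.filter fun m => ∑ i, m i * d i = ∑ i, m₀ i * d i with hT
  have hsum : ∑ m ∈ T, algebraMap k B (g.coeff m) * ∏ i, q i ^ m i = 0 := by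
    have h1 := congrArg (fun f => (Φ f).coeff (∑ i, m₀ i * d i)) (hexp.symm.trans h)
    simp only [map_sum, Polynomial.finsetSum_coeff] at h1
    rw [map_zero, Polynomial.coeff_zero] at h1
    refine Eq.trans ?_ h1
    rw [hT, Finset.sum_filter]
    refine Finset.sum_congr rfl fun m _ => ?_
    rw [hΦ m, Polynomial.coeff_monomial]
  obtain ⟨m₁, hm₁, hmin⟩ := T.exists_min_image (fun m => m 0)
    ⟨m₀, Finset.mem_filter.2 ⟨hm₀, rfl⟩⟩
  obtain ⟨hm₁g, hm₁d⟩ := Finset.mem_filter.1 hm₁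
  have hlt : ∀ m ∈ T, m ≠ m₁ → m₁ 0 < m 0 := by
    intro m hm hne
    refine lt_of_le_of_ne (hmin m hm) fun h0 => hne ?_
    obtain ⟨hmg, hmd⟩ := Finset.mem_filter.1 hm
    have hdeg := hmd.trans hm₁d.symm
    have hz : ∀ i : Fin n, m i.succ.succ = m₁ i.succ.succ := fun i =>
      (hmod _ _ hdeg i).eq_of_lt_of_lt (hg hmg i) (hg hm₁g i)
    simp only [Fin.sum_univ_succ, hz, ← h0, add_right_inj, add_left_inj] at hdeg
    have h1 := Nat.eq_of_mul_eq_mul_right (hd _) hdeg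
    ext i
    refine Fin.cases h0.symm (fun i => Fin.cases h1 hz i) i
  have hdiv : q 0 ^ (m₁ 0 + 1) ∣ algebraMap k B (g.coeff m₁) * ∏ i, q i ^ m₁ i := by
    rw [← Finset.add_sum_erase _ _ hm₁] at hsum
    rw [eq_neg_of_add_eq_zero_left hsum, dvd_neg]
    refine Finset.dvd_sum fun m hm => Dvd.dvd.mul_left ?_ _
    obtain ⟨hne, hmT⟩ := Finset.mem_erase.1 hm
    exact (pow_dvd_pow _ (hlt m hmT hne)).trans
      (Finset.dvd_prod_of_mem (fun i => q i ^ m i) (Finset.mem_univ 0))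
  rw [Fin.prod_univ_succ, mul_left_comm, pow_succ,
    mul_dvd_mul_iff_left (pow_ne_zero _ (hq 0).ne_zero)] at hdiv
  rcases (hq 0).dvd_or_dvd hdiv with h1 | h1
  · refine (hq 0).not_isUnit (isUnit_of_dvd_unit h1 ?_)
    exact (IsUnit.mk0 _ (mem_support_iff.1 hm₁g)).map (algebraMap k B)
  · obtain ⟨i, -, hi⟩ := (hq 0).exists_mem_finset_dvd h1
    exact hdvd 0 i.succ (Fin.succ_ne_zero i).symm ((hq 0).dvd_of_dvd_pow hi)

theorem nonempty_algEquiv_moriRing {k B : Type*} [Field k] [CommRing B]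
    [IsDomain B] [Algebra k B] {Φ : B →ₐ[k] Polynomial B} {n a b : ℕ} {c : Fin n → ℕ}
    {lam : Fin n → k} {q : Fin (n + 2) → B} {d : Fin (n + 2) → ℕ} (hq : ∀ i, Prime (q i))
    (hhom : ∀ i, IsHomog Φ (d i) (q i)) (hd : ∀ i, 0 < d i)
    (hdvd : ∀ i j, i ≠ j → ¬ q i ∣ q j) (hc : ∀ i, 0 < c i)
    (hrel : ∀ i : Fin n, q 0 ^ a + algebraMap k B (lam i) * q 1 ^ b + q i.succ.succ ^ c i = 0)
    (hgen : Algebra.adjoin k (Set.range q) = ⊤)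
    (hmod : ∀ m m' : Fin (n + 2) →₀ ℕ, ∑ i, m i * d i = ∑ i, m' i * d i →
      ∀ i : Fin n, m i.succ.succ ≡ m' i.succ.succ [MOD c i]) :
    Nonempty (B ≃ₐ[k] MoriRing k n a b c lam) := by
  have hsurj : Function.Surjective (aeval q : MvPolynomial (Fin (n + 2)) k →ₐ[k] B) := by
    rw [← AlgHom.range_eq_top, ← Algebra.adjoin_range_eq_range_aeval, hgen]
  have hker : Ideal.span (Set.range fun i : Fin n => (X 0 : MvPolynomial (Fin (n + 2)) k) ^ a +
      C (lam i) * X 1 ^ b + X i.succ.succ ^ c i) =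
      RingHom.ker (aeval q : MvPolynomial (Fin (n + 2)) k →ₐ[k] B) := by
    have hle : Ideal.span (Set.range fun i : Fin n => (X 0 : MvPolynomial (Fin (n + 2)) k) ^ a +
        C (lam i) * X 1 ^ b + X i.succ.succ ^ c i) ≤
        RingHom.ker (aeval q : MvPolynomial (Fin (n + 2)) k →ₐ[k] B) := by
      rw [Ideal.span_le]
      rintro _ ⟨i, rfl⟩
      simpa [algebraMap_eq] using hrel i
    refine le_antisymm hle fun f hf => ?_
    obtain ⟨g, hg, u, hu, rfl⟩ := Submodule.mem_sup.1
      (mem_restrictSupport_reducedExponents_sup (a := a) (b := b) lam hc f)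
    have hu' := hle hu
    rw [RingHom.mem_ker] at hf hu'
    rw [map_add, hu', add_zero] at hf
    rw [eq_zero_of_aeval_eq_zero_of_mem_restrictSupport hq hhom hd hdvd hmod hg hf, zero_add]
    exact hu
  exact ⟨((Ideal.quotientEquivAlgOfEq k hker).trans
    (Ideal.quotientKerAlgEquivOfSurjective hsurj)).symm⟩

theorem IsHomog.exists_algebraMap_of_isUnit {k B : Type*} [Field k] [CommRing B] [IsDomain B]
    [Algebra k B] {Φ : B →ₐ[k] Polynomial B} (hΦ : IsPosCoaction Φ) {n : ℕ} {f : B}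
    (hf : IsHomog Φ n f) (hu : IsUnit f) : ∃ c : k, f = algebraMap k B c := by
  obtain rfl : n = 0 := by
    by_contra h0
    exact hf.not_isUnit hΦ (Nat.pos_of_ne_zero h0) hu
  exact hf.exists_algebraMap hΦ

theorem multiplicity_prod_pow_of_prime {B ι : Type*} [CommRing B] [IsDomain B]
    [UniqueFactorizationMonoid B] [Fintype ι] [DecidableEq ι] {q : ι → B} (hq : ∀ i, Prime (q i))
    (hdvd : ∀ i j, i ≠ j → ¬ q i ∣ q j) (m : ι → ℕ) (j : ι) :
    multiplicity (q j) (∏ i, q i ^ m i) = m j := by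
  have h0 : ∀ i, q i ^ m i ≠ 0 := fun i => pow_ne_zero _ (hq i).ne_zero
  rw [← Finset.mul_prod_erase _ _ (Finset.mem_univ j),
    multiplicity_mul_of_prime (hq j) (h0 j) (Finset.prod_ne_zero_iff.2 fun i _ => h0 i),
    multiplicity_pow_self (hq j).ne_zero (hq j).not_isUnit, multiplicity_eq_zero.2, add_zero]
  intro h
  obtain ⟨i, hi, hij⟩ := (hq j).exists_mem_finset_dvd h
  exact hdvd j i (Finset.ne_of_mem_erase hi).symm ((hq j).dvd_of_dvd_pow hij)

namespace IsPrimePencil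

variable {k B : Type*} [Field k] [CommRing B] [Algebra k B]
  {Φ : B →ₐ[k] Polynomial B} {d : ℕ} {p : Option k → B} {e : Option k → ℕ}

theorem adjoin_eq_top [IsDomain B] [UniqueFactorizationMonoid B] (hΦ : IsPosCoaction Φ)
    (hp : IsPrimePencil Φ d p e) : Algebra.adjoin k (Set.range p) = ⊤ := by
  have h : ∀ f : B, ∀ n, IsHomog Φ n f → f ∈ Algebra.adjoin k (Set.range p) := by
    intro f
    induction f using UniqueFactorizationMonoid.induction_on_prime with
    | h₁ => exact fun _ _ => zero_mem _
    | h₂ f hf =>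
      intro n hn
      obtain ⟨c, rfl⟩ := hn.exists_algebraMap_of_isUnit hΦ hf
      exact algebraMap_mem _ c
    | h₃ f q hf hq ih =>
      intro n hn
      obtain ⟨r, s, hr, hs, -⟩ := IsHomog.of_mul hΦ (mul_ne_zero hq.ne_zero hf) hn
      refine mul_mem ?_ (ih s hs)
      obtain ⟨P, hP⟩ := hp.exists_associated r q hq hr
      obtain ⟨u, rfl⟩ := hP.symm
      obtain ⟨-, t, -, ht, -⟩ := IsHomog.of_mul hΦ hq.ne_zero hr
      obtain ⟨c, hc⟩ := ht.exists_algebraMap_of_isUnit hΦ u.isUnit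
      rw [hc]
      exact mul_mem (Algebra.subset_adjoin ⟨P, rfl⟩) (algebraMap_mem _ c)
  rw [eq_top_iff]
  rintro f -
  rw [hΦ.sum_coeff f]
  exact sum_mem fun n _ => h _ n (hΦ.isHomog_coeff f n)

theorem nonempty_algEquiv_moriRing [IsDomain B] [UniqueFactorizationMonoid B] (hΦ : IsPosCoaction Φ)
    (hp : IsPrimePencil Φ d p e) {n a b : ℕ} {c : Fin n → ℕ} {lam : Fin n → k}
    {σ : Fin (n + 2) → Option k} (hσ : Function.Injective σ)
    (he : ∀ P, P ∉ Set.range σ → e P = 1) {τ : Fin (n + 2) → k} (hτ : ∀ i, τ i ≠ 0)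
    (hc : ∀ i, c i = e (σ i.succ.succ)) {q : Fin (n + 2) → B}
    (hq : ∀ i, q i = algebraMap k B (τ i) * p (σ i))
    (hrel : ∀ i : Fin n, q 0 ^ a + algebraMap k B (lam i) * q 1 ^ b + q i.succ.succ ^ c i = 0) :
    Nonempty (B ≃ₐ[k] MoriRing k n a b c lam) := by
  have hass : ∀ i, Associated (p (σ i)) (q i) := fun i => by
    rw [hq i]
    exact (associated_unit_mul_left _ _ ((IsUnit.mk0 _ (hτ i)).map (algebraMap k B))).symm
  have hprime : ∀ i, Prime (q i) := fun i => (hass i).prime (hp.prime _)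
  have hdvd : ∀ i j, i ≠ j → ¬ q i ∣ q j := fun i j hij h =>
    hp.not_dvd _ _ (hσ.ne hij) ((hass i).dvd.trans (h.trans (hass j).symm.dvd))
  choose δ hδ hhom _ using fun P => hp.exists_isHomog P
  have hhomq : ∀ i, IsHomog Φ (δ (σ i)) (q i) := fun i => by
    rw [hq i]
    exact (hhom _).algebraMap_mul _
  have hmem : ∀ i, p (σ i) ∈ Algebra.adjoin k (Set.range q) := fun i => by
    have h1 : p (σ i) = algebraMap k B (τ i)⁻¹ * q i := by
      rw [hq i, ← mul_assoc, ← map_mul, inv_mul_cancel₀ (hτ i), map_one, one_mul]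
    rw [h1]
    exact mul_mem (algebraMap_mem _ _) (Algebra.subset_adjoin ⟨i, rfl⟩)
  refine _root_.nonempty_algEquiv_moriRing (d := fun i => δ (σ i)) hprime hhomq (fun i => hδ _) hdvd
    (fun i => hc i ▸ hp.exponent_pos _) hrel ?_ ?_
  · rw [eq_top_iff, ← hp.adjoin_eq_top hΦ, Algebra.adjoin_le_iff]
    rintro _ ⟨P, rfl⟩
    by_cases hP : P ∈ Set.range σ
    · obtain ⟨i, rfl⟩ := hP
      exact hmem i
    · obtain ⟨s, t, -, -, h⟩ := hp.isPencil.exists_eq (σ 0) (σ 1) P (hσ.ne (by simp))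
        (fun h => hP ⟨0, h.symm⟩) (fun h => hP ⟨1, h.symm⟩)
      rw [he P hP, pow_one] at h
      rw [h]
      exact add_mem (mul_mem (algebraMap_mem _ _) (pow_mem (hmem 0) _))
        (mul_mem (algebraMap_mem _ _) (pow_mem (hmem 1) _))
  · intro m m' hmm' i
    have hhomm : ∀ m : Fin (n + 2) →₀ ℕ, IsHomog Φ (∑ i, m i * δ (σ i)) (∏ i, q i ^ m i) :=
      fun m => .prod _ fun i => (hhomq i).pow (m i)
    have hne : ∀ m : Fin (n + 2) →₀ ℕ, ∏ i, q i ^ m i ≠ 0 := fun m =>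
      Finset.prod_ne_zero_iff.2 fun i _ => pow_ne_zero _ (hprime i).ne_zero
    have h := hp.modEq _ _ _ (hhomm m) (hmm' ▸ hhomm m') (hne m) (hne m') (σ i.succ.succ)
    rwa [← multiplicity_eq_of_associated_left (hass _),
      ← multiplicity_eq_of_associated_left (hass _),
      multiplicity_prod_pow_of_prime hprime hdvd, multiplicity_prod_pow_of_prime hprime hdvd,
      ← hc] at h

theorem finite_setOf_two_le (hp : IsPrimePencil Φ d p e) : {P | 2 ≤ e P}.Finite := by
  refine Set.Finite.of_finite_image (f := e) ((Set.finite_Iic d).subset ?_) ?_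
  · rintro _ ⟨P, -, rfl⟩
    obtain ⟨n, -, -, hn⟩ := hp.exists_isHomog P
    exact Nat.le_of_dvd hp.isPencil.pos ⟨n, hn.symm⟩
  · intro P hP Q _ hPQ
    by_contra hne
    have h := hp.coprime P Q hne
    rw [← hPQ, Nat.coprime_self] at h
    exact absurd hP (by simp [h])

theorem exists_enumeration [Infinite k] (hp : IsPrimePencil Φ d p e) :
    ∃ (n : ℕ) (σ : Fin (n + 2) → Option k), Function.Injective σ ∧
      (∀ P, P ∉ Set.range σ → e P = 1) ∧
      (n = 0 ∨ StrictAnti (e ∘ σ) ∧ ∀ i, 2 ≤ e (σ i)) := by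
  classical
  set S := hp.finite_setOf_two_le.toFinset with hS
  have hS' : ∀ P, P ∈ S ↔ 2 ≤ e P := fun P => by simp [hS]
  have hone : ∀ P, P ∉ S → e P = 1 := fun P hP => by
    have := hp.exponent_pos P
    rw [hS'] at hP
    omega
  rcases le_total S.card 2 with h | h
  · obtain ⟨T, hST, hT⟩ := Infinite.exists_superset_card_eq S 2 h
    let ε := T.equivFinOfCardEq hT
    refine ⟨0, fun i => ε.symm i, Subtype.val_injective.comp ε.symm.injective,
      fun P hP => hone P fun hPS => hP ⟨ε ⟨P, hST hPS⟩, by simp⟩, Or.inl rfl⟩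
  · obtain ⟨n, hn⟩ := Nat.exists_eq_add_of_le' h
    have hinj : Set.InjOn e S := by
      intro P hP Q _ hPQ
      by_contra hne
      have h := hp.coprime P Q hne
      rw [← hPQ, Nat.coprime_self] at h
      exact absurd ((hS' P).1 hP) (by simp [h])
    have hcard : (S.image e).card = n + 2 := by rw [Finset.card_image_of_injOn hinj, hn]
    have hmem : ∀ i, ∃ P ∈ S, e P = (S.image e).orderEmbOfFin hcard (Fin.rev i) := fun i =>
      Finset.mem_image.1 (Finset.orderEmbOfFin_mem _ hcard _)
    choose σ hσS hσ using hmem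
    have hanti : StrictAnti (e ∘ σ) := fun i j hij => by
      simp only [Function.comp_apply, hσ]
      exact ((S.image e).orderEmbOfFin hcard).strictMono (Fin.rev_lt_rev.2 hij)
    refine ⟨n, σ, hanti.injective.of_comp, fun P hP => hone P fun hPS => hP ?_,
      Or.inr ⟨hanti, fun i => (hS' _).1 (hσS i)⟩⟩
    have h1 : e P ∈ Set.range ((S.image e).orderEmbOfFin hcard) := by
      rw [Finset.range_orderEmbOfFin]
      exact Finset.mem_coe.2 (Finset.mem_image_of_mem e hPS)
    obtain ⟨i, hi⟩ := h1
    exact ⟨Fin.rev i, hinj (hσS _) hPS (by rw [hσ, Fin.rev_rev, hi])⟩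

theorem exists_moriRing [IsDomain B] [IsAlgClosed k]
    [UniqueFactorizationMonoid B] (hΦ : IsPosCoaction Φ)
    (hp : IsPrimePencil Φ d p e) :
    ∃ (n : ℕ) (a b : ℕ) (c : Fin n → ℕ) (lam : Fin n → k),
      b < a ∧ (∀ i, c i < b) ∧ StrictAnti c ∧ (∀ i, 2 ≤ c i) ∧
      Nat.Coprime a b ∧ (∀ i, Nat.Coprime a (c i)) ∧ (∀ i, Nat.Coprime b (c i)) ∧
      (∀ i j : Fin n, i ≠ j → Nat.Coprime (c i) (c j)) ∧
      (∀ i : Fin n, (i : ℕ) = 0 → lam i = 1) ∧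
      (∀ i, lam i ≠ 0) ∧ Function.Injective lam ∧
      Nonempty (B ≃ₐ[k] MoriRing k n a b c lam) := by
  obtain ⟨n, σ, hσ, he, rfl | ⟨hanti, htwo⟩⟩ := hp.exists_enumeration
  · refine ⟨0, 2, 1, Fin.elim0, Fin.elim0, by norm_num, fun i => i.elim0, fun i => i.elim0,
      fun i => i.elim0, by norm_num, fun i => i.elim0, fun i => i.elim0, fun i => i.elim0,
      fun i => i.elim0, fun i => i.elim0, fun i => i.elim0, ?_⟩
    exact hp.nonempty_algEquiv_moriRing hΦ hσ he (τ := fun _ => 1) (fun _ => one_ne_zero)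
      (fun i => i.elim0) (fun _ => rfl) fun i => i.elim0
  have h01 : σ 0 ≠ σ 1 := hσ.ne (by simp)
  have hi0 : ∀ i : Fin n, i.succ.succ ≠ 0 := fun i => Fin.succ_ne_zero _
  have hi1 : ∀ i : Fin n, i.succ.succ ≠ 1 := fun i h =>
    Fin.succ_ne_zero i (Fin.succ_injective _ (by simpa using h))
  choose s t hs ht hst using fun i : Fin n => hp.isPencil.exists_eq (σ 0) (σ 1) (σ i.succ.succ) h01
    (hσ.ne (hi0 i)) (hσ.ne (hi1 i))
  obtain ⟨u, hu, hu1⟩ : ∃ u : k, u ≠ 0 ∧ ∀ i : Fin n, (i : ℕ) = 0 → t i / s i = u := by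
    rcases n with _ | n
    · exact ⟨1, one_ne_zero, fun i => i.elim0⟩
    · refine ⟨t 0 / s 0, div_ne_zero (ht 0) (hs 0), fun i hi => ?_⟩
      obtain rfl : i = 0 := Fin.ext hi
      rfl
  obtain ⟨y, hy⟩ := IsAlgClosed.exists_pow_nat_eq u (hp.exponent_pos (σ 1))
  choose ρ hρ using fun i : Fin n =>
    IsAlgClosed.exists_pow_nat_eq (-(s i)⁻¹) (hp.exponent_pos (σ i.succ.succ))
  let τ : Fin (n + 2) → k := Fin.cons 1 (Fin.cons y ρ)
  let q : Fin (n + 2) → B := fun i => algebraMap k B (τ i) * p (σ i)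
  have hy0 : y ≠ 0 := by
    rintro rfl
    exact hu (by rw [← hy, zero_pow (hp.exponent_pos _).ne'])
  have hρ0 : ∀ i, ρ i ≠ 0 := fun i h => by
    have := hρ i
    rw [h, zero_pow (hp.exponent_pos _).ne'] at this
    exact neg_ne_zero.2 (inv_ne_zero (hs i)) this.symm
  have hτ : ∀ i, τ i ≠ 0 := Fin.cases one_ne_zero (Fin.cases hy0 hρ0)
  have hrel : ∀ i : Fin n, q 0 ^ e (σ 0) + algebraMap k B (t i / s i / u) * q 1 ^ e (σ 1) +
      q i.succ.succ ^ e (σ i.succ.succ) = 0 := by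
    intro i
    have h0 : q 0 = p (σ 0) := by
      change algebraMap k B 1 * _ = _
      rw [map_one, one_mul]
    have h1 : q 1 ^ e (σ 1) = algebraMap k B u * p (σ 1) ^ e (σ 1) := by
      change (algebraMap k B y * p (σ 1)) ^ _ = _
      rw [mul_pow, ← map_pow, hy]
    have h2 : q i.succ.succ ^ e (σ i.succ.succ) =
        algebraMap k B (-(s i)⁻¹) * p (σ i.succ.succ) ^ e (σ i.succ.succ) := by
      change (algebraMap k B (ρ i) * p (σ i.succ.succ)) ^ _ = _
      rw [mul_pow, ← map_pow, hρ]
    have h3 : algebraMap k B (t i / s i / u) * algebraMap k B u = algebraMap k B (t i / s i) := by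
      rw [← map_mul, div_mul_cancel₀ _ hu]
    have h4 : algebraMap k B (s i)⁻¹ * algebraMap k B (s i) = 1 := by
      rw [← map_mul, inv_mul_cancel₀ (hs i), map_one]
    have h5 := hst i
    rw [h0, h1, h2, h5, ← mul_assoc, h3, div_eq_mul_inv, map_mul, map_neg]
    linear_combination (-p (σ 0) ^ e (σ 0)) * h4
  have hcop : ∀ i j, i ≠ j → (e (σ i)).Coprime (e (σ j)) := fun i j h => hp.coprime _ _ (hσ.ne h)
  refine ⟨n, e (σ 0), e (σ 1), fun i => e (σ i.succ.succ), fun i => t i / s i / u,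
    hanti (by simp), fun i => hanti ?_, fun i j hij => hanti (by simpa using hij),
    fun i => htwo _, hcop _ _ (by simp), fun i => hcop _ _ (hi0 i).symm,
    fun i => hcop _ _ (hi1 i).symm, fun i j hij => hcop _ _ (by simpa using hij),
    fun i hi => by simp only [hu1 i hi, div_self hu],
    fun i => div_ne_zero (div_ne_zero (ht i) (hs i)) hu,
    fun i j hij => ?_, hp.nonempty_algEquiv_moriRing hΦ hσ he hτ (fun _ => rfl) (fun _ => rfl) hrel⟩
  · exact lt_of_le_of_ne (Fin.one_le_of_ne_zero (hi0 i)) (hi1 i).symm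
  · by_contra hne
    have h1 := hrel i
    dsimp only at hij
    rw [hij] at h1
    have h2 := add_left_cancel (h1.trans (hrel j).symm)
    have h3 : p (σ i.succ.succ) ∣ q j.succ.succ ^ e (σ j.succ.succ) := by
      rw [← h2]
      exact (Dvd.intro_left _ rfl).trans (dvd_pow_self _ (hp.exponent_pos _).ne')
    have h4 := (hp.prime _).dvd_of_dvd_pow h3
    have h5 := ((IsUnit.mk0 _ (hτ j.succ.succ)).map (algebraMap k B)).dvd_mul_left.1 h4
    exact hp.not_dvd _ _ (hσ.ne (by simpa using hne)) h5

end IsPrimePencil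

/-- Let `k` be an algebraically closed field and `B` a unique
factorization domain containing `k` such that `B` has transcendence degree 2 over `k`,
the fraction field of `B` is a purely transcendental extension of `k` of transcendence
degree 2, and `B` admits a positive ℤ-grading over `k`.  Then there exist `n ≥ 0`,
pairwise relatively prime integers `a > b > c_1 > ⋯ > c_n ≥ 2` and distinct
`λ_1 = 1, λ_2, …, λ_n ∈ k*` with
`B ≅_k k[x, y, z_1, …, z_n]/(x^a + λ_i y^b + z_i^{c_i})_{1 ≤ i ≤ n}`; in particular
`B` is a finitely generated `k`-algebra. -/
theorem stmt_14 {k B : Type*} [Field k] [IsAlgClosed k]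
    [CommRing B] [IsDomain B] [UniqueFactorizationMonoid B] [Algebra k B]
    (htr1 : ∃ s : Fin 2 → B, AlgebraicIndependent k s)
    (htr2 : ∀ t : Fin 3 → B, ¬ AlgebraicIndependent k t)
    (hrat : ∃ e : FractionRing B ≃+* FractionRing (MvPolynomial (Fin 2) k),
      ∀ x : k,
        e (algebraMap B (FractionRing B) (algebraMap k B x)) =
          algebraMap (MvPolynomial (Fin 2) k) (FractionRing (MvPolynomial (Fin 2) k)) (C x))
    (hgr : HasPositiveZGrading k B) :
    ∃ (n : ℕ) (a b : ℕ) (c : Fin n → ℕ) (lam : Fin n → k),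
      b < a ∧ (∀ i, c i < b) ∧ StrictAnti c ∧ (∀ i, 2 ≤ c i) ∧
      Nat.Coprime a b ∧ (∀ i, Nat.Coprime a (c i)) ∧ (∀ i, Nat.Coprime b (c i)) ∧
      (∀ i j : Fin n, i ≠ j → Nat.Coprime (c i) (c j)) ∧
      (∀ i : Fin n, (i : ℕ) = 0 → lam i = 1) ∧
      (∀ i, lam i ≠ 0) ∧ Function.Injective lam ∧
      Nonempty (B ≃ₐ[k] MoriRing k n a b c lam) ∧
      Algebra.FiniteType k B := by
  obtain ⟨s, hs⟩ := htr1
  obtain ⟨e, he⟩ := hrat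
  obtain ⟨Φ, hΦ⟩ := hgr.exists_isPosCoaction
  let E : FractionRing B ≃ₐ[k] FractionRing (MvPolynomial (Fin 2) k) :=
    AlgEquiv.ofRingEquiv (f := e) fun x => by
      rw [IsScalarTower.algebraMap_apply k B, he,
        IsScalarTower.algebraMap_apply k (MvPolynomial (Fin 2) k), MvPolynomial.algebraMap_eq]
  obtain ⟨d, L, hL⟩ := exists_isPencil hΦ hs E
  obtain ⟨p, ε, hp⟩ := hL.exists_isPrimePencil hΦ
  obtain ⟨n, a, b, c, lam, h1, h2, h3, h4, h5, h6, h7, h8, h9, h10, h11, ⟨φ⟩⟩ :=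
    hp.exists_moriRing hΦ
  exact ⟨n, a, b, c, lam, h1, h2, h3, h4, h5, h6, h7, h8, h9, h10, h11, ⟨φ⟩,
    Algebra.FiniteType.equiv (inferInstance : Algebra.FiniteType k (MoriRing k n a b c lam)) φ.symm⟩
end

section
/- Let k be a field, n ≥ 0, let a > b > c_1 > ⋯ > c_n ≥ 2 be pairwise relatively prime integers, let λ_1 = 1, λ_2, …, λ_n ∈ k* be distinct, and let B = k[x, y, z_1, …, z_n]/(x^a + λ_i y^b + z_i^{c_i})_{1 ≤ i ≤ n}. Then the minimum number of elements needed to generate B as a k-algebra is n + 2. -/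
set_option synthInstance.maxHeartbeats 1000000
set_option maxHeartbeats 1000000

open MvPolynomial

/-- If a set generates a `k`-algebra that maps to the square-zero extension `k ⊕ M`,
then the `M`-components of its image span every `M`-component of the image. -/
theorem snd_mem_span_of_adjoin_eq_top {k A M : Type*} [Field k] [CommRing A] [Algebra k A]
    [AddCommGroup M] [Module k M] [Module kᵐᵒᵖ M] [IsCentralScalar k M]
    (φ : A →ₐ[k] TrivSqZeroExt k M) {s : Set A} (hs : Algebra.adjoin k s = ⊤) (r : A) :
    (φ r).snd ∈ Submodule.span k ((fun t => (φ t).snd) '' s) := by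
  have hr : r ∈ Algebra.adjoin k s := hs ▸ Algebra.mem_top
  induction hr using Algebra.adjoin_induction with
  | mem x hx => exact Submodule.subset_span ⟨x, hx, rfl⟩
  | algebraMap t => simp [TrivSqZeroExt.algebraMap_eq_inl]
  | add x y _ _ hx hy => simpa using Submodule.add_mem _ hx hy
  | mul x y _ _ hx hy =>
    simpa using Submodule.add_mem _ (Submodule.smul_mem _ (φ x).fst hy)
      (Submodule.smul_mem _ (φ y).fst hx)

/-- The powers of order at least two of a square-zero element vanish. -/
theorem TrivSqZeroExt.inr_pow_eq_zero {k M : Type*} [CommRing k] [AddCommGroup M] [Module k M]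
    [Module kᵐᵒᵖ M] [IsCentralScalar k M] (v : M) {m : ℕ} (hm : 2 ≤ m) :
    (TrivSqZeroExt.inr v : TrivSqZeroExt k M) ^ m = 0 :=
  pow_eq_zero_of_le hm (by rw [pow_two, TrivSqZeroExt.inr_mul_inr])

/-- When all the exponents are at least two, the ring `B` maps to the square-zero extension
of `k` by its cotangent space at the origin. -/
theorem MoriRing.exists_toTrivSqZeroExt {k : Type*} [Field k] (n a b : ℕ) (c : Fin n → ℕ)
    (lam : Fin n → k) (ha : ∀ _ : Fin n, 2 ≤ a) (hb : ∀ _ : Fin n, 2 ≤ b) (hc : ∀ i, 2 ≤ c i) :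
    ∃ φ : MoriRing k n a b c lam →ₐ[k] TrivSqZeroExt k (Fin (n + 2) → k),
      ∀ i, φ (Ideal.Quotient.mk _ (X i)) = TrivSqZeroExt.inr (Pi.single i 1) := by
  let ψ : MvPolynomial (Fin (n + 2)) k →ₐ[k] TrivSqZeroExt k (Fin (n + 2) → k) :=
    aeval fun i => TrivSqZeroExt.inr (Pi.single i 1)
  have hψ : ∀ i, ψ (X i) = TrivSqZeroExt.inr (Pi.single i 1) := fun i => aeval_X _ i
  have hker : Ideal.span (Set.range fun i : Fin n =>
      (X 0 : MvPolynomial (Fin (n + 2)) k) ^ a + C (lam i) * X 1 ^ b +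
        X i.succ.succ ^ c i) ≤ RingHom.ker ψ := by
    rw [Ideal.span_le]
    rintro _ ⟨i, rfl⟩
    simp only [SetLike.mem_coe, RingHom.mem_ker, map_add, map_mul, map_pow, hψ,
      TrivSqZeroExt.inr_pow_eq_zero _ (ha i), TrivSqZeroExt.inr_pow_eq_zero _ (hb i),
      TrivSqZeroExt.inr_pow_eq_zero _ (hc i), mul_zero, add_zero]
  exact ⟨Ideal.Quotient.liftₐ _ ψ fun p hp => hker hp, hψ⟩

/-- Let `k` be a field, `n ≥ 0`, `a > b > c_1 > ⋯ > c_n ≥ 2` pairwise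
relatively prime integers, `λ_1 = 1, λ_2, …, λ_n ∈ k*` distinct, and
`B = k[x, y, z_1, …, z_n]/(x^a + λ_i y^b + z_i^{c_i})_{1 ≤ i ≤ n}`.  Then the minimum
number of elements needed to generate `B` as a `k`-algebra is `n + 2`. -/
theorem stmt_15 {k : Type*} [Field k]
    (n : ℕ) (a b : ℕ) (c : Fin n → ℕ) (lam : Fin n → k)
    (hba : b < a) (hcb : ∀ i, c i < b) (hmono : StrictAnti c) (hc2 : ∀ i, 2 ≤ c i)
    (hab : Nat.Coprime a b) (hac : ∀ i, Nat.Coprime a (c i))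
    (hbc : ∀ i, Nat.Coprime b (c i))
    (hcc : ∀ i j : Fin n, i ≠ j → Nat.Coprime (c i) (c j))
    (hlam1 : ∀ i : Fin n, (i : ℕ) = 0 → lam i = 1)
    (hlam0 : ∀ i, lam i ≠ 0) (hlaminj : Function.Injective lam) :
    (∃ s : Finset (MoriRing k n a b c lam), s.card = n + 2 ∧
      Algebra.adjoin k (s : Set (MoriRing k n a b c lam)) = ⊤) ∧
    (∀ s : Finset (MoriRing k n a b c lam),
      Algebra.adjoin k (s : Set (MoriRing k n a b c lam)) = ⊤ → n + 2 ≤ s.card) := by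
  classical
  obtain ⟨φ, hφ⟩ := MoriRing.exists_toTrivSqZeroExt n a b c lam
    (fun i => ((hc2 i).trans (hcb i).le).trans hba.le) (fun i => (hc2 i).trans (hcb i).le) hc2
  constructor
  · let g : Fin (n + 2) → MoriRing k n a b c lam := fun i => Ideal.Quotient.mk _ (X i)
    have hg : Function.Injective g := fun i j hij => by
      have h := congrArg φ hij
      simp only [g, hφ] at h
      by_contra hne
      have hcoord := congrFun (TrivSqZeroExt.inr_injective h) i
      simp [hne] at hcoord
    refine ⟨Finset.univ.image g, by simp [Finset.card_image_of_injective _ hg], ?_⟩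
    have himg : ((Finset.univ.image g : Finset _) : Set (MoriRing k n a b c lam)) =
        Ideal.Quotient.mkₐ k _ '' Set.range (X : Fin (n + 2) → MvPolynomial (Fin (n + 2)) k) := by
      rw [Finset.coe_image, Finset.coe_univ, Set.image_univ, ← Set.range_comp]
      rfl
    rw [himg, ← AlgHom.map_adjoin, adjoin_range_X, Algebra.map_top, AlgHom.range_eq_top]
    exact Ideal.Quotient.mkₐ_surjective k _
  · intro s hs
    have hspan : Submodule.span k
        (s.image fun t => (φ t).snd : Set (Fin (n + 2) → k)) = ⊤ := by
      rw [eq_top_iff, ← (Pi.basisFun k (Fin (n + 2))).span_eq, Submodule.span_le]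
      rintro _ ⟨i, rfl⟩
      have h := snd_mem_span_of_adjoin_eq_top φ hs (Ideal.Quotient.mk _ (X i))
      rw [hφ] at h
      simpa using h
    have h := finrank_span_finset_le_card (R := k) (s.image fun t => (φ t).snd)
    rw [Set.finrank, hspan, finrank_top, Module.finrank_fin_fun] at h
    exact h.trans Finset.card_image_le
end

section
/- Let k be a field of characteristic 0, let n ≥ 1, let a > b > c_1 > ⋯ > c_n ≥ 2 be pairwise relatively prime integers with (a, b, c_i) ≠ (5, 3, 2) for every i, let λ_1 = 1, λ_2, …, λ_n ∈ k* be distinct, and let B = k[x, y, z_1, …, z_n]/(x^a + λ_i y^b + z_i^{c_i})_{1 ≤ i ≤ n}. If R is a unique factorization domain containing B such that B is factorially closed in R, then B is contained in the Makar-Limanov invariant ML(R); that is, every locally nilpotent k-derivation of R vanishes on B. In particular (taking R = B), B is rigides. -/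
set_option synthInstance.maxHeartbeats 1000000
set_option maxHeartbeats 1000000

open MvPolynomial

namespace Derivation

section Exponential

variable {k R : Type*} [Field k] [CommRing R] [Algebra k R]

/-- Iterated Leibniz rule. -/
theorem iterate_apply_mul (D : Derivation k R R) (n : ℕ) (r s : R) :
    D^[n] (r * s) =
      ∑ ij ∈ Finset.HasAntidiagonal.antidiagonal n, n.choose ij.1 • (D^[ij.1] r * D^[ij.2] s) := by
  induction n with
  | zero => simp
  | succ n ih =>
    rw [Finset.sum_antidiagonal_choose_succ_nsmul (fun i j => D^[i] r * D^[j] s) n,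
      Function.iterate_succ_apply', ih, map_sum, ← Finset.sum_add_distrib]
    refine Finset.sum_congr rfl fun ij hij => ?_
    rw [map_nsmul, D.leibniz, Function.iterate_succ_apply', Function.iterate_succ_apply',
      smul_eq_mul, smul_eq_mul, nsmul_add,
      Nat.choose_symm_of_eq_add (Finset.HasAntidiagonal.mem_antidiagonal.mp hij).symm,
      mul_comm (D^[ij.2] s)]

theorem iterate_apply_smul (D : Derivation k R R) (n : ℕ) (t : k) (r : R) :
    D^[n] (t • r) = t • D^[n] r := by
  induction n with
  | zero => rfl
  | succ n ih => rw [Function.iterate_succ_apply', ih, D.map_smul, Function.iterate_succ_apply']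

theorem iterate_neg_apply (D : Derivation k R R) (n : ℕ) (r : R) :
    (⇑(-D))^[n] r = (-1 : k) ^ n • D^[n] r := by
  induction n with
  | zero => simp
  | succ n ih =>
    rw [Function.iterate_succ_apply', ih, Function.iterate_succ_apply', pow_succ]
    simp

theorem iterate_eq_zero_of_le (D : Derivation k R R) {r : R} {N n : ℕ} (h : D^[N] r = 0)
    (hn : N ≤ n) : D^[n] r = 0 := by
  obtain ⟨m, rfl⟩ := Nat.exists_eq_add_of_le' hn
  rw [Function.iterate_add_apply, h, iterate_map_zero]

/-- A derivation is locally nilpotent if each element is killed by some iterate. -/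
def IsLocallyNilpotent (D : Derivation k R R) : Prop :=
  ∀ r : R, ∃ N : ℕ, D^[N] r = 0

theorem IsLocallyNilpotent.neg {D : Derivation k R R} (hD : D.IsLocallyNilpotent) :
    (-D).IsLocallyNilpotent := fun r => by
  obtain ⟨N, hN⟩ := hD r
  exact ⟨N, by rw [iterate_neg_apply, hN, smul_zero]⟩

/-- The polynomial `∑ Dⁱ(r) / i! Tⁱ`. -/
noncomputable def expAux (D : Derivation k R R) (hD : D.IsLocallyNilpotent) (r : R) :
    Polynomial R :=
  ∑ i ∈ Finset.range (hD r).choose, Polynomial.monomial i ((i.factorial : k)⁻¹ • D^[i] r)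

theorem coeff_expAux (D : Derivation k R R) (hD : D.IsLocallyNilpotent) (r : R) (n : ℕ) :
    (D.expAux hD r).coeff n = (n.factorial : k)⁻¹ • D^[n] r := by
  simp only [expAux, Polynomial.finsetSum_coeff, Polynomial.coeff_monomial,
    Finset.sum_ite_eq', Finset.mem_range]
  split_ifs with h
  · rfl
  · rw [D.iterate_eq_zero_of_le (hD r).choose_spec (not_lt.mp h), smul_zero]

variable [CharZero k]

/-- The exponential `r ↦ ∑ Dⁱ(r) / i! Tⁱ` of a locally nilpotent derivation, as a ring
homomorphism into the polynomial ring. -/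
noncomputable def expHom (D : Derivation k R R) (hD : D.IsLocallyNilpotent) :
    R →+* Polynomial R where
  toFun := D.expAux hD
  map_zero' := by ext n; simp [coeff_expAux, iterate_map_zero]
  map_one' := by
    ext n
    rw [coeff_expAux]
    cases n with
    | zero => simp
    | succ n => simp [Function.iterate_succ_apply, iterate_map_zero, Polynomial.coeff_one]
  map_add' r s := by
    ext n
    simp only [Polynomial.coeff_add, coeff_expAux, iterate_map_add, smul_add]
  map_mul' r s := by
    ext n
    simp only [Polynomial.coeff_mul, coeff_expAux, iterate_apply_mul, Finset.smul_sum]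
    refine Finset.sum_congr rfl fun ij hij => ?_
    obtain rfl := Finset.HasAntidiagonal.mem_antidiagonal.mp hij
    rw [smul_mul_smul_comm, ← Nat.cast_smul_eq_nsmul k, smul_smul]
    congr 1
    have h := Nat.choose_mul_factorial_mul_factorial (Nat.le_add_right ij.1 ij.2)
    rw [Nat.add_sub_cancel_left] at h
    have h1 : ((ij.1 + ij.2).factorial : k) ≠ 0 := by exact_mod_cast Nat.factorial_ne_zero _
    have h2 : (ij.1.factorial : k) ≠ 0 := by exact_mod_cast Nat.factorial_ne_zero _
    have h3 : (ij.2.factorial : k) ≠ 0 := by exact_mod_cast Nat.factorial_ne_zero _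
    rw [← h] at h1 ⊢
    push_cast at h1 ⊢
    have h4 := left_ne_zero_of_mul (left_ne_zero_of_mul h1)
    field_simp

theorem coeff_expHom (D : Derivation k R R) (hD : D.IsLocallyNilpotent) (r : R) (n : ℕ) :
    (D.expHom hD r).coeff n = (n.factorial : k)⁻¹ • D^[n] r :=
  D.coeff_expAux hD r n

theorem expHom_injective (D : Derivation k R R) (hD : D.IsLocallyNilpotent) :
    Function.Injective (D.expHom hD) := fun r s h => by
  simpa [coeff_expHom] using congrArg (fun p => Polynomial.coeff p 0) h

theorem apply_eq_zero_of_natDegree_expHom (D : Derivation k R R) (hD : D.IsLocallyNilpotent)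
    {r : R} (h : (D.expHom hD r).natDegree = 0) : D r = 0 := by
  have h1 : (D.expHom hD r).coeff 1 = 0 := Polynomial.coeff_eq_zero_of_natDegree_lt (by omega)
  simpa [coeff_expHom] using h1

theorem expHom_algebraMap (D : Derivation k R R) (hD : D.IsLocallyNilpotent) (t : k) :
    D.expHom hD (algebraMap k R t) = Polynomial.C (algebraMap k R t) := by
  ext n
  rw [coeff_expHom, Polynomial.coeff_C]
  cases n with
  | zero => simp
  | succ n => simp [Function.iterate_succ_apply, iterate_map_zero]

/-- The exponential of a locally nilpotent derivation, extended to the polynomial ring by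
fixing the variable. -/
noncomputable def expEnd (D : Derivation k R R) (hD : D.IsLocallyNilpotent) :
    Polynomial R →+* Polynomial R :=
  Polynomial.eval₂RingHom (D.expHom hD) Polynomial.X

theorem expEnd_C (D : Derivation k R R) (hD : D.IsLocallyNilpotent) (r : R) :
    D.expEnd hD (Polynomial.C r) = D.expHom hD r := by
  simp [expEnd]

theorem sum_inv_factorial_mul_neg_one_pow (m : ℕ) :
    ∑ i ∈ Finset.range (m + 1),
      (((m - i).factorial : k)⁻¹ * (-1) ^ (m - i) * (i.factorial : k)⁻¹) =
        if m = 0 then 1 else 0 := by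
  have h := congrArg (fun z : ℤ => (z : k) * (m.factorial : k)⁻¹)
    (Int.alternating_sum_range_choose (n := m))
  have hm : ∀ j : ℕ, (j.factorial : k) ≠ 0 := fun j => by
    exact_mod_cast Nat.factorial_ne_zero _
  rw [← Finset.sum_range_reflect]
  push_cast at h
  rw [Finset.sum_mul] at h
  refine Eq.trans (Finset.sum_congr rfl fun i hi => ?_) (h.trans ?_)
  · have hi' : i ≤ m := Nat.lt_succ_iff.mp (Finset.mem_range.mp hi)
    have h1 : m - (m + 1 - 1 - i) = i := by omega
    have h2 : m + 1 - 1 - i = m - i := by omega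
    rw [h1, h2, Nat.cast_choose k hi']
    have := hm m; have := hm i; have := hm (m - i)
    field_simp
  · split_ifs with h0 <;> simp [h0]

theorem expEnd_neg_expHom (D : Derivation k R R) (hD : D.IsLocallyNilpotent) (r : R) :
    (-D).expEnd hD.neg (D.expHom hD r) = Polynomial.C r := by
  ext m
  have hN : (D.expHom hD r).natDegree < (D.expHom hD r).natDegree + m + 1 := by omega
  rw [expEnd, Polynomial.coe_eval₂RingHom, Polynomial.eval₂_eq_sum_range' _ hN,
    Polynomial.finsetSum_coeff]
  have hsub : Finset.range (m + 1) ⊆ Finset.range ((D.expHom hD r).natDegree + m + 1) :=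
    Finset.range_mono (by omega)
  rw [← Finset.sum_subset hsub]
  · have : ∀ i ∈ Finset.range (m + 1),
        ((-D).expHom hD.neg ((D.expHom hD r).coeff i) * Polynomial.X ^ i).coeff m =
        (((m - i).factorial : k)⁻¹ * (-1) ^ (m - i) * (i.factorial : k)⁻¹) • D^[m] r := by
      intro i hi
      have hi' : i ≤ m := Nat.lt_succ_iff.mp (Finset.mem_range.mp hi)
      rw [Polynomial.coeff_mul_X_pow', if_pos hi', coeff_expHom, coeff_expHom,
        iterate_neg_apply, iterate_apply_smul, ← Function.iterate_add_apply,
        Nat.sub_add_cancel hi', smul_smul, smul_smul, mul_assoc]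
    rw [Finset.sum_congr rfl this, ← Finset.sum_smul, sum_inv_factorial_mul_neg_one_pow, Polynomial.coeff_C]
    split_ifs with h
    · simp [h]
    · simp
  · intro i _ hi
    rw [Polynomial.coeff_mul_X_pow', if_neg (by simpa using hi)]

theorem expEnd_neg_expEnd (D : Derivation k R R) (hD : D.IsLocallyNilpotent)
    (p : Polynomial R) : (-D).expEnd hD.neg (D.expEnd hD p) = p := by
  have : ((-D).expEnd hD.neg).comp (D.expEnd hD) = RingHom.id _ := by
    apply Polynomial.ringHom_ext
    · intro r
      simp [expEnd_C, expEnd_neg_expHom]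
    · simp [expEnd]
  exact RingHom.congr_fun this p

theorem expEnd_expEnd_neg (D : Derivation k R R) (hD : D.IsLocallyNilpotent)
    (p : Polynomial R) : D.expEnd hD ((-D).expEnd hD.neg p) = p := by
  have h := (-D).expEnd_neg_expEnd hD.neg p
  simpa only [neg_neg] using h

theorem isRelPrime_expHom [IsDomain R] (D : Derivation k R R) (hD : D.IsLocallyNilpotent) {x y : R}
    (hx : x ≠ 0) (h : IsRelPrime x y) : IsRelPrime (D.expHom hD x) (D.expHom hD y) := by
  intro d hdx hdy
  have hdx' := map_dvd ((-D).expEnd hD.neg) hdx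
  have hdy' := map_dvd ((-D).expEnd hD.neg) hdy
  rw [expEnd_neg_expHom] at hdx' hdy'
  obtain ⟨e, he⟩ : ∃ e, (-D).expEnd hD.neg d = Polynomial.C e :=
    ⟨_, Polynomial.eq_C_of_natDegree_eq_zero (by
      simpa using Polynomial.natDegree_le_of_dvd hdx' (Polynomial.C_ne_zero.mpr hx))⟩
  rw [he, Polynomial.C_dvd_iff_dvd_coeff] at hdx' hdy'
  have hu : IsUnit e := h (by simpa using hdx' 0) (by simpa using hdy' 0)
  have h2 := (hu.map Polynomial.C).map (D.expEnd hD)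
  rwa [← he, expEnd_expEnd_neg] at h2

end Exponential

end Derivation

/-- Relatively prime polynomials over a unique factorization domain become coprime over its
fraction field. -/
theorem IsRelPrime.isCoprime_map_fractionRing {R : Type*} [CommRing R] [IsDomain R]
    [UniqueFactorizationMonoid R] {p q : Polynomial R} (hp : p ≠ 0) (h : IsRelPrime p q) :
    IsCoprime (p.map (algebraMap R (FractionRing R))) (q.map (algebraMap R (FractionRing R))) := by
  let : NormalizedGCDMonoid R := Nonempty.some inferInstance
  refine IsRelPrime.isCoprime fun g hgp hgq => ?_
  have hg : g ≠ 0 := by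
    rintro rfl
    exact hp ((Polynomial.map_eq_zero_iff (IsFractionRing.injective R (FractionRing R))).mp
      (zero_dvd_iff.mp hgp))
  apply Polynomial.isUnit_or_eq_zero_of_isUnit_integerNormalization_primPart (R := R) hg
  set G := IsLocalization.integerNormalization (nonZeroDivisors R) g with hG
  have hG0 : G ≠ 0 := by rwa [hG, Ne, IsFractionRing.integerNormalization_eq_zero_iff]
  have key : ∀ r : Polynomial R, g ∣ r.map (algebraMap R (FractionRing R)) →
      G.primPart ∣ r := by
    intro r hr
    obtain ⟨c, hc0, hc⟩ := IsLocalization.integerNormalization_spec (nonZeroDivisors R) g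
    have hc0' : algebraMap R (FractionRing R) c ≠ 0 := by
      simpa using nonZeroDivisors.ne_zero hc0
    have h1 : G.primPart.map (algebraMap R (FractionRing R)) ∣ g := by
      have : G.primPart.map (algebraMap R (FractionRing R)) ∣ G.map (algebraMap R _) :=
        Polynomial.map_dvd _ G.primPart_dvd
      rw [hc, Algebra.smul_def, Polynomial.algebraMap_apply] at this
      exact ((Polynomial.isUnit_C.mpr hc0'.isUnit).dvd_mul_left).mp this
    exact (Polynomial.isPrimitive_primPart G).dvd_of_fraction_map_dvd_fraction_map (h1.trans hr)
  exact h (key p hgp) (key q hgq)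

namespace Derivation

/-- If `x` and `y` are relatively prime elements of a unique factorization domain and
`x ^ a + t y ^ b + z ^ c = 0` with `1 / a + 1 / b + 1 / c ≤ 1`, then every locally nilpotent
derivation vanishes at `x`, `y` and `z`. -/
theorem IsLocallyNilpotent.apply_eq_zero_of_trinomial {k R : Type*} [Field k] [CharZero k]
    [CommRing R] [IsDomain R] [UniqueFactorizationMonoid R] [Algebra k R]
    {D : Derivation k R R} (hD : D.IsLocallyNilpotent) {a b c : ℕ} (ha : a ≠ 0) (hb : b ≠ 0)
    (hc : c ≠ 0) (habc : b * c + c * a + a * b ≤ a * b * c) {t : k} (ht : t ≠ 0) {x y z : R}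
    (hx : x ≠ 0) (hy : y ≠ 0) (hxy : IsRelPrime x y)
    (h : x ^ a + algebraMap k R t * y ^ b + z ^ c = 0) : D x = 0 ∧ D y = 0 ∧ D z = 0 := by
  let F := FractionRing R
  have hinj : Function.Injective (algebraMap R F) := IsFractionRing.injective R F
  have hF : Function.Injective (algebraMap k F) := (algebraMap k F).injective
  have : CharZero F := charZero_of_injective_algebraMap hF
  let φ : R →+* Polynomial F := (Polynomial.mapRingHom (algebraMap R F)).comp (D.expHom hD)
  have hφ : Function.Injective φ :=
    (Polynomial.map_injective _ hinj).comp (D.expHom_injective hD)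
  have hφ0 : ∀ {r : R}, r ≠ 0 → φ r ≠ 0 := fun hr => (map_ne_zero_iff φ hφ).mpr hr
  have hdeg : ∀ {r : R}, (φ r).natDegree = 0 → D r = 0 := fun hr =>
    D.apply_eq_zero_of_natDegree_expHom hD
      (by rwa [← Polynomial.natDegree_map_eq_of_injective hinj])
  have hcop : IsCoprime (φ x) (φ y) :=
    (D.isRelPrime_expHom hD hx hxy).isCoprime_map_fractionRing
      ((map_ne_zero_iff _ (D.expHom_injective hD)).mpr hx)
  have ht' : algebraMap k F t ≠ 0 := (map_ne_zero_iff _ hF).mpr ht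
  have heq : Polynomial.C 1 * φ x ^ a + Polynomial.C (algebraMap k F t) * φ y ^ b +
      Polynomial.C 1 * φ z ^ c = 0 := by
    have := congrArg φ h
    have ht : φ (algebraMap k R t) = Polynomial.C (algebraMap k F t) := by
      simp [φ, expHom_algebraMap, IsScalarTower.algebraMap_apply k R F]
    simpa only [map_add, map_mul, map_pow, map_zero, ht, Polynomial.C_1, one_mul] using this
  rcases eq_or_ne z 0 with rfl | hz
  · rw [map_zero, zero_pow hc, mul_zero, add_zero, Polynomial.C_1, one_mul] at heq
    have hcop' : IsCoprime (φ x ^ a) (φ y ^ b) := hcop.pow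
    have hux : IsUnit (φ x ^ a) := hcop'.isUnit_of_dvd' dvd_rfl
      (((Polynomial.isUnit_C.mpr ht'.isUnit).dvd_mul_left).mp
        ⟨-1, by linear_combination heq⟩)
    have huy : IsUnit (φ y ^ b) := hcop'.isUnit_of_dvd'
      ⟨-Polynomial.C (algebraMap k F t), by linear_combination heq⟩ dvd_rfl
    exact ⟨hdeg (Polynomial.natDegree_eq_zero_of_isUnit ((isUnit_pow_iff ha).mp hux)),
      hdeg (Polynomial.natDegree_eq_zero_of_isUnit ((isUnit_pow_iff hb).mp huy)), map_zero D⟩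
  · obtain ⟨h1, h2, h3⟩ := Polynomial.flt_catalan ha hb hc habc (Nat.cast_ne_zero.mpr ha)
      (Nat.cast_ne_zero.mpr hb) (Nat.cast_ne_zero.mpr hc) (hφ0 hx) (hφ0 hy) (hφ0 hz) hcop
      one_ne_zero ht' one_ne_zero heq
    exact ⟨hdeg h1, hdeg h2, hdeg h3⟩

end Derivation

theorem trinomial_exponents_le {a b c : ℕ} (hba : b < a) (hcb : c < b) (hc : 2 ≤ c)
    (hac : Nat.Coprime a c) (hbc : Nat.Coprime b c) (h532 : ¬ (a = 5 ∧ b = 3 ∧ c = 2)) :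
    b * c + c * a + a * b ≤ a * b * c := by
  rcases hc.eq_or_lt with rfl | hc3
  · have ha : a % 2 = 1 := Nat.odd_iff.mp (Nat.coprime_two_right.mp hac)
    have hb : b % 2 = 1 := Nat.odd_iff.mp (Nat.coprime_two_right.mp hbc)
    rcases (show b = 3 ∨ 5 ≤ b by omega) with rfl | hb5
    · omega
    · nlinarith
  · have h1 : b * c ≤ a * b := by nlinarith
    have h2 : c * a ≤ a * b := by nlinarith
    nlinarith [Nat.mul_le_mul_left (a * b) hc3]

namespace MoriRing

section Curve

variable {k : Type*} [Field k] {n a b : ℕ} {c : Fin n → ℕ} {lam : Fin n → k}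

/-- The point `(T ^ (b P), T ^ (a P), …)` of `B` over the polynomial ring, where `P = ∏ c_i`,
together with the restrictions it puts on the low order coefficients. -/
theorem exists_curve (hb : 0 < b) (ha : 0 < a) (hc0 : ∀ i, 0 < c i) (hcb : ∀ i, c i < b) :
    ∃ φ : MoriRing k n a b c lam →ₐ[k] Polynomial (AlgebraicClosure k),
      φ (Ideal.Quotient.mk _ (X 0)) = Polynomial.X ^ (b * ∏ i, c i) ∧
      φ (Ideal.Quotient.mk _ (X 1)) = Polynomial.X ^ (a * ∏ i, c i) ∧
      (∀ f, (φ (Ideal.Quotient.mk _ f)).coeff 0 =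
        algebraMap k (AlgebraicClosure k) (constantCoeff f)) ∧
      ∀ β m, m < a * ∏ i, c i → ¬ (b * ∏ i, c i) ∣ m → (φ β).coeff m = 0 := by
  set P := ∏ i, c i with hP
  have hP0 : 0 < P := Finset.prod_pos fun i _ => hc0 i
  have hζ : ∀ i, ∃ ζ : AlgebraicClosure k,
      ζ ^ c i = -(1 + algebraMap k (AlgebraicClosure k) (lam i)) := fun i =>
    IsAlgClosed.exists_pow_nat_eq _ (hc0 i)
  choose ζ hζ using hζ
  have he : ∀ i, ∃ e, e * c i = a * b * P := fun i => by
    obtain ⟨q, hq⟩ := Finset.dvd_prod_of_mem c (Finset.mem_univ i)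
    exact ⟨a * b * q, by rw [hP, hq]; ring⟩
  choose e he using he
  have heP : ∀ i, a * P < e i := fun i => by
    by_contra! hle
    have h1 := Nat.mul_le_mul_right (c i) hle
    rw [he i] at h1
    have h2 : a * P * c i < a * P * b :=
      Nat.mul_lt_mul_of_pos_left (hcb i) (Nat.mul_pos ha hP0)
    nlinarith
  let v : Fin (n + 2) → Polynomial (AlgebraicClosure k) :=
    Fin.cons (Polynomial.X ^ (b * P)) (Fin.cons (Polynomial.X ^ (a * P))
      fun i => Polynomial.C (ζ i) * Polynomial.X ^ e i)
  have hv0 : v 0 = Polynomial.X ^ (b * P) := rfl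
  have hv1 : v 1 = Polynomial.X ^ (a * P) := rfl
  have hv2 : ∀ i : Fin n, v i.succ.succ = Polynomial.C (ζ i) * Polynomial.X ^ e i := fun _ => rfl
  have hrel : ∀ f ∈ Ideal.span (Set.range fun i : Fin n =>
      (X 0 : MvPolynomial (Fin (n + 2)) k) ^ a + C (lam i) * X 1 ^ b +
        X i.succ.succ ^ c i), aeval v f = 0 := by
    intro f hf
    refine (Ideal.span_le (I := RingHom.ker (aeval (R := k) v))).mpr ?_ hf
    rintro _ ⟨i, rfl⟩
    simp only [SetLike.mem_coe, RingHom.mem_ker, map_add, map_mul, map_pow, aeval_X, aeval_C,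
      hv0, hv1, hv2, mul_pow, ← pow_mul, he, ← Polynomial.C_pow, hζ,
      Polynomial.algebraMap_apply]
    rw [show b * P * a = a * b * P by ring, show a * P * b = a * b * P by ring]
    simp only [map_neg, map_add, map_one]
    ring
  have hcoeff : ∀ (f : MvPolynomial (Fin (n + 2)) k) (m : ℕ), m < a * P → ¬ (b * P) ∣ m →
      (aeval v f).coeff m = 0 := by
    intro f
    induction f using MvPolynomial.induction_on with
    | C r =>
      intro m _ hm
      rw [aeval_C, Polynomial.algebraMap_apply, Polynomial.coeff_C,
        if_neg (by rintro rfl; exact hm (dvd_zero _))]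
    | add f g hf hg =>
      intro m h1 h2
      rw [map_add, Polynomial.coeff_add, hf m h1 h2, hg m h1 h2, add_zero]
    | mul_X f i hf =>
      intro m h1 h2
      rw [map_mul, aeval_X]
      refine Fin.cases ?_ (fun i => Fin.cases ?_ (fun i => ?_) i) i
      · rw [hv0, Polynomial.coeff_mul_X_pow']
        split_ifs with hle
        · exact hf _ (by omega) fun hd => h2 ((Nat.dvd_sub_iff_left hle dvd_rfl).mp hd)
        · rfl
      · exact (Polynomial.coeff_mul_X_pow' _ _ _).trans (if_neg (by omega))
      · rw [hv2, mul_left_comm, Polynomial.coeff_C_mul, Polynomial.coeff_mul_X_pow',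
          if_neg (by have := heP i; omega), mul_zero]
  refine ⟨Ideal.Quotient.liftₐ _ (aeval v) hrel, ?_, ?_, fun f => ?_, fun β m h1 h2 => ?_⟩
  · exact (aeval_X _ _).trans hv0
  · exact (aeval_X _ _).trans hv1
  · change (aeval v f).coeff 0 = _
    induction f using MvPolynomial.induction_on with
    | C r => simp [Polynomial.algebraMap_apply]
    | add f g hf hg => simp [hf, hg]
    | mul_X f i hf =>
      have : (v i).coeff 0 = 0 := by
        refine Fin.cases ?_ (fun i => Fin.cases ?_ (fun i => ?_) i) i
        · simp [hv0, hb.ne', hP0.ne', Polynomial.coeff_X_pow]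
        · exact (Polynomial.coeff_X_pow _ _).trans (if_neg (Nat.mul_pos ha hP0).ne)
        · rw [hv2, Polynomial.coeff_C_mul, Polynomial.coeff_X_pow,
            if_neg (by have := heP i; omega), mul_zero]
      simp [Polynomial.mul_coeff_zero, this]
  · obtain ⟨f, rfl⟩ := Ideal.Quotient.mk_surjective β
    exact hcoeff f m h1 h2

/-- A common divisor of all the generators of `B` is a unit. -/
theorem isUnit_of_dvd_generators (hb : 2 ≤ b) (hba : b < a) (hab : Nat.Coprime a b)
    (hc0 : ∀ i, 0 < c i) (hcb : ∀ i, c i < b) {p : MoriRing k n a b c lam}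
    (hp : ∀ i, p ∣ Ideal.Quotient.mk _ (X i)) : IsUnit p := by
  obtain ⟨φ, hφx, hφy, hφ0, hφ⟩ :=
    exists_curve (lam := lam) (a := a) (b := b) (by omega) (by omega) hc0 hcb
  set P := ∏ i, c i
  have hP0 : 0 < P := Finset.prod_pos fun i _ => hc0 i
  obtain ⟨f, rfl⟩ := Ideal.Quotient.mk_surjective p
  have hsub : ∀ g : MvPolynomial (Fin (n + 2)) k,
      Ideal.Quotient.mk _ f ∣ (Ideal.Quotient.mk _ (g - C (constantCoeff g)) :
        MoriRing k n a b c lam) := by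
    intro g
    induction g using MvPolynomial.induction_on with
    | C r => simp
    | add g h hg hh =>
      have := dvd_add hg hh
      rw [← map_add] at this
      convert this using 2
      simp
      ring
    | mul_X g i _ =>
      simpa using (hp i).mul_left (Ideal.Quotient.mk _ g)
  by_cases hf : constantCoeff f = 0
  · exfalso
    obtain ⟨x', hx'⟩ := hp 0
    obtain ⟨y', hy'⟩ := hp 1
    have hx := congrArg φ hx'
    have hy := congrArg φ hy'
    rw [hφx, map_mul] at hx
    rw [hφy, map_mul] at hy
    obtain ⟨m, hm, hassoc⟩ := (dvd_prime_pow Polynomial.prime_X _).mp (Dvd.intro _ hx.symm)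
    obtain ⟨u, hu⟩ := hassoc.symm
    obtain ⟨r, hr, hru⟩ := Polynomial.isUnit_iff.mp u.isUnit
    have hr0 : r ≠ 0 := hr.ne_zero
    rw [← hru] at hu
    have hcf : ∀ j, (φ (Ideal.Quotient.mk _ f)).coeff j = if j = m then r else 0 := fun j => by
      rw [← hu, Polynomial.coeff_mul_C, Polynomial.coeff_X_pow]
      split_ifs <;> simp
    have hlt : b * P < a * P := Nat.mul_lt_mul_of_pos_right hba hP0
    have hm0 : m ≠ 0 := by
      rintro rfl
      have h1 := hφ0 f
      rw [hf, map_zero, hcf, if_pos rfl] at h1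
      exact hr0 h1
    have hmb : m = b * P := by
      by_contra hne
      have h1 := hφ (Ideal.Quotient.mk _ f) m (by omega)
        (fun hd => hne (le_antisymm hm (Nat.le_of_dvd (Nat.pos_of_ne_zero hm0) hd)))
      rw [hcf, if_pos rfl] at h1
      exact hr0 h1
    subst hmb
    have hnd : ¬ (b * P) ∣ (a - b) * P := fun hd => by
      have h1 : b ∣ a - b := Nat.dvd_of_mul_dvd_mul_right hP0 hd
      have h2 : b ∣ a := (Nat.dvd_sub_iff_left hba.le dvd_rfl).mp h1
      have := Nat.eq_one_of_dvd_coprimes hab h2 dvd_rfl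
      omega
    have h1 := hφ y' ((a - b) * P)
      (Nat.mul_lt_mul_of_pos_right (by omega) hP0) hnd
    have h2 := congrArg (fun q => Polynomial.coeff q (a * P)) hy
    simp only [← hu] at h2
    rw [Polynomial.coeff_X_pow_self, mul_assoc, Polynomial.coeff_X_pow_mul', if_pos hlt.le,
      Polynomial.coeff_C_mul, ← Nat.sub_mul, h1, mul_zero] at h2
    exact one_ne_zero h2
  · have h1 := (dvd_sub_right (dvd_refl _)).mp (by simpa only [map_sub] using hsub f)
    refine isUnit_of_dvd_unit h1 ?_
    exact ((isUnit_iff_ne_zero.mpr hf).map C).map (Ideal.Quotient.mk _)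

end Curve

end MoriRing

/-- Let `k` be a field of characteristic 0, `n ≥ 1`,
`a > b > c_1 > ⋯ > c_n ≥ 2` pairwise relatively prime with `(a, b, c_i) ≠ (5, 3, 2)` for
every `i`, `λ_1 = 1, λ_2, …, λ_n ∈ k*` distinct, and
`B = k[x, y, z_1, …, z_n]/(x^a + λ_i y^b + z_i^{c_i})_{1 ≤ i ≤ n}`.  If `R` is a unique
factorization domain containing `B` (via an injective algebra map) such that `B` is
factorially closed in `R`, then `B ⊆ ML(R)`: every locally nilpotent `k`-derivation of
`R` vanishes on (the image of) `B`.  In particular (taking `R = B`), `B` is rigid. -/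
theorem stmt_16 {k : Type*} [Field k] [CharZero k]
    (n : ℕ) (hn : 1 ≤ n) (a b : ℕ) (c : Fin n → ℕ) (lam : Fin n → k)
    (hba : b < a) (hcb : ∀ i, c i < b) (hmono : StrictAnti c) (hc2 : ∀ i, 2 ≤ c i)
    (hab : Nat.Coprime a b) (hac : ∀ i, Nat.Coprime a (c i))
    (hbc : ∀ i, Nat.Coprime b (c i))
    (hcc : ∀ i j : Fin n, i ≠ j → Nat.Coprime (c i) (c j))
    (h532 : ∀ i : Fin n, ¬ (a = 5 ∧ b = 3 ∧ c i = 2))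
    (hlam1 : ∀ i : Fin n, (i : ℕ) = 0 → lam i = 1)
    (hlam0 : ∀ i, lam i ≠ 0) (hlaminj : Function.Injective lam)
    (R : Type*) [CommRing R] [IsDomain R] [UniqueFactorizationMonoid R]
    [Algebra k R] [Algebra (MoriRing k n a b c lam) R]
    [IsScalarTower k (MoriRing k n a b c lam) R]
    (hinj : Function.Injective (algebraMap (MoriRing k n a b c lam) R))
    (hfc : ∀ u v : R, u ≠ 0 → v ≠ 0 →
      u * v ∈ (algebraMap (MoriRing k n a b c lam) R).range →
      u ∈ (algebraMap (MoriRing k n a b c lam) R).range ∧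
        v ∈ (algebraMap (MoriRing k n a b c lam) R).range) :
    ∀ D : Derivation k R R, (∀ r : R, ∃ N : ℕ, (fun x => D x)^[N] r = 0) →
      ∀ x : MoriRing k n a b c lam, D (algebraMap (MoriRing k n a b c lam) R x) = 0 := by
  intro D hD
  have hD' : D.IsLocallyNilpotent := hD
  let ι : MvPolynomial (Fin (n + 2)) k →+* R :=
    (algebraMap (MoriRing k n a b c lam) R).comp (Ideal.Quotient.mk _)
  have hι : ∀ f, ι f = algebraMap (MoriRing k n a b c lam) R (Ideal.Quotient.mk _ f) :=
    fun _ => rfl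
  have hιC : ∀ r, ι (C r) = algebraMap k R r := fun r =>
    (IsScalarTower.algebraMap_apply k (MoriRing k n a b c lam) R r).symm
  let i₀ : Fin n := ⟨0, hn⟩
  have hb3 : 3 ≤ b := by have := hcb i₀; have := hc2 i₀; omega
  have hc0 : ∀ i, 0 < c i := fun i => by have := hc2 i; omega
  have hrel : ∀ i : Fin n,
      ι (X 0) ^ a + algebraMap k R (lam i) * ι (X 1) ^ b + ι (X i.succ.succ) ^ c i = 0 := by
    intro i
    rw [← hιC, ← map_pow, ← map_pow, ← map_pow, ← map_mul, ← map_add, ← map_add, hι,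
      Ideal.Quotient.eq_zero_iff_mem.mpr (Ideal.subset_span (Set.mem_range_self i)), map_zero]
  obtain ⟨φ, hφx, hφy, -, -⟩ := MoriRing.exists_curve (lam := lam) (a := a) (b := b)
    (by omega) (by omega) hc0 hcb
  have hx0 : ι (X 0) ≠ 0 := fun h => by
    rw [hι, map_eq_zero_iff _ hinj] at h
    exact pow_ne_zero _ Polynomial.X_ne_zero
      (hφx.symm.trans ((congrArg φ h).trans (map_zero φ)))
  have hy0 : ι (X 1) ≠ 0 := fun h => by
    rw [hι, map_eq_zero_iff _ hinj] at h
    exact pow_ne_zero _ Polynomial.X_ne_zero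
      (hφy.symm.trans ((congrArg φ h).trans (map_zero φ)))
  have hdvd : ∀ p q : MoriRing k n a b c lam,
      algebraMap _ R p ∣ algebraMap _ R q → p ∣ q := by
    rintro p q ⟨w, hw⟩
    rcases eq_or_ne q 0 with rfl | hq
    · exact dvd_zero _
    have hq0 : algebraMap _ R q ≠ 0 := (map_ne_zero_iff _ hinj).mpr hq
    rw [hw] at hq0
    obtain ⟨-, w', rfl⟩ := hfc _ w (left_ne_zero_of_mul hq0) (right_ne_zero_of_mul hq0)
      ⟨q, hw⟩
    exact ⟨w', hinj (by rw [hw, map_mul])⟩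
  have hrp : IsRelPrime (ι (X 0)) (ι (X 1)) := by
    rw [UniqueFactorizationMonoid.isRelPrime_iff_no_prime_factors hx0]
    intro d hdx hdy hd
    obtain ⟨w, hw⟩ := hdx
    obtain ⟨⟨p, rfl⟩, -⟩ := hfc d w hd.ne_zero (right_ne_zero_of_mul (hw ▸ hx0))
      ⟨Ideal.Quotient.mk _ (X 0), hw⟩
    refine hd.not_isUnit ((MoriRing.isUnit_of_dvd_generators (by omega) hba hab hc0 hcb
      fun i => hdvd p _ ?_).map (algebraMap (MoriRing k n a b c lam) R))
    refine Fin.cases ⟨w, hw⟩ (fun i => Fin.cases hdy (fun i => ?_) i) i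
    refine hd.dvd_of_dvd_pow (n := c i) ((dvd_add_right ?_).mp ((hrel i).symm ▸ dvd_zero _))
    exact dvd_add (dvd_pow ⟨w, hw⟩ (by omega)) ((dvd_pow hdy (by omega)).mul_left _)
  have hzero : ∀ i : Fin n, D (ι (X 0)) = 0 ∧ D (ι (X 1)) = 0 ∧ D (ι (X i.succ.succ)) = 0 :=
    fun i => hD'.apply_eq_zero_of_trinomial (by omega) (by omega) (hc0 i).ne'
      (trinomial_exponents_le hba (hcb i) (hc2 i) (hac i) (hbc i) (h532 i)) (hlam0 i) hx0 hy0 hrp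
      (hrel i)
  intro x
  obtain ⟨f, rfl⟩ := Ideal.Quotient.mk_surjective x
  change D (ι f) = 0
  induction f using MvPolynomial.induction_on with
  | C r => rw [hιC, D.map_algebraMap]
  | add f g hf hg => rw [map_add, map_add, hf, hg, add_zero]
  | mul_X f i hf =>
    have hi : D (ι (X i)) = 0 :=
      Fin.cases (hzero i₀).1 (fun i => Fin.cases (hzero i₀).2.1 (fun i => (hzero i).2.2) i) i
    rw [map_mul, D.leibniz, hf, hi, smul_zero, smul_zero, add_zero]
end
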